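/- arXiv:2004.09207 — 2 statements merged into one kernel-verified Lean document; each statement's English description precedes it below -/
import Mathlib

section
/- Let G be a planar graph on n vertices and let S be a subset of V(G) with |S| = k, where k ≥ 3 and n ≥ 3. Then the sum of the degrees (in G) of the vertices in S is at most 2n + 6k − 16. -/
/-- `H` is a minor of `G`: there is a family of nonempty, pairwise disjoint, connected
branch sets in `G`, one for each vertex of `H`, with an edge of `G` between the branch
sets of any two adjacent vertices of `H`. -/
def SimpleGraph.IsMinorOf {W V : Type*} (H : SimpleGraph W) (G : SimpleGraph V) : Prop :=
  ∃ φ : W → Set V,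
    (∀ w, (φ w).Nonempty) ∧
    (∀ w, (G.induce (φ w)).Connected) ∧
    (Pairwise fun w₁ w₂ => Disjoint (φ w₁) (φ w₂)) ∧
    ∀ ⦃w₁ w₂⦄, H.Adj w₁ w₂ → ∃ a ∈ φ w₁, ∃ b ∈ φ w₂, G.Adj a b

/-- A graph is planar iff it has no `K₅` minor and no `K₃,₃` minor (Wagner's theorem). -/
def SimpleGraph.IsPlanar {V : Type*} (G : SimpleGraph V) : Prop :=
  ¬ (completeGraph (Fin 5)).IsMinorOf G ∧
  ¬ (completeBipartiteGraph (Fin 3) (Fin 3)).IsMinorOf G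

namespace PlanarAux
open Finset
open scoped Classical

variable {V W : Type*}

/-- step relation inside a set -/
def St (G : SimpleGraph V) (S : Set V) (a b : V) : Prop := G.Adj a b ∧ a ∈ S ∧ b ∈ S

theorem rtg_mono {r s : V → V → Prop} (h : ∀ a b, r a b → s a b) {a b : V}
    (hab : Relation.ReflTransGen r a b) : Relation.ReflTransGen s a b :=
  by
  induction hab with
  | refl => exact .refl
  | tail _ h2 ih => exact ih.tail (h _ _ h2)

/-- every element of `S` is reachable from `r` inside `S` -/
def Rt (G : SimpleGraph V) (S : Set V) (r : V) : Prop :=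
  r ∈ S ∧ ∀ u ∈ S, Relation.ReflTransGen (St G S) r u

theorem St.symm {G : SimpleGraph V} {S : Set V} {a b : V} (h : St G S a b) : St G S b a :=
  ⟨h.1.symm, h.2.2, h.2.1⟩

theorem rtg_symm {G : SimpleGraph V} {S : Set V} {a b : V}
    (h : Relation.ReflTransGen (St G S) a b) : Relation.ReflTransGen (St G S) b a := by
  induction h with
  | refl => exact .refl
  | tail _ h2 ih => exact Relation.ReflTransGen.head h2.symm ih

theorem Rt.change {G : SimpleGraph V} {S : Set V} {r s : V} (h : Rt G S r) (hs : s ∈ S) :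
    Rt G S s :=
  ⟨hs, fun u hu => (rtg_symm (h.2 s hs)).trans (h.2 u hu)⟩

theorem conn_of_rt {G : SimpleGraph V} {S : Set V} {r : V} (h : Rt G S r) :
    (G.induce S).Connected := by
  have key : ∀ u, Relation.ReflTransGen (St G S) r u → ∀ hu : u ∈ S,
      (G.induce S).Reachable ⟨r, h.1⟩ ⟨u, hu⟩ := by
    intro u hu
    induction hu with
    | refl => intro _; exact SimpleGraph.Reachable.refl _
    | tail h1 h2 ih =>
      intro hu
      refine (ih h2.2.1).trans (SimpleGraph.Adj.reachable ?_)
      exact h2.1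
  have : Nonempty S := ⟨⟨r, h.1⟩⟩
  refine SimpleGraph.Connected.mk ?_
  intro a b
  exact (key a (h.2 a a.2) a.2).symm.trans (key b (h.2 b b.2) b.2)

/-- minor inside a set of vertices -/
def MI (H : SimpleGraph W) (G : SimpleGraph V) (X : Finset V) : Prop :=
  ∃ φ : W → Set V,
    (∀ w, ∃ r, Rt G (φ w) r) ∧
    (Pairwise fun w₁ w₂ => Disjoint (φ w₁) (φ w₂)) ∧
    (∀ ⦃w₁ w₂⦄, H.Adj w₁ w₂ → ∃ a ∈ φ w₁, ∃ b ∈ φ w₂, G.Adj a b) ∧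
    ∀ w, φ w ⊆ (X : Set V)

theorem MI.isMinor {H : SimpleGraph W} {G : SimpleGraph V} {X : Finset V} (h : MI H G X) :
    H.IsMinorOf G := by
  obtain ⟨φ, h1, h2, h3, h4⟩ := h
  exact ⟨φ, fun w => ⟨_, (h1 w).choose_spec.1⟩, fun w => conn_of_rt (h1 w).choose_spec, h2, h3⟩

theorem MI.mono {H : SimpleGraph W} {G : SimpleGraph V} {X Y : Finset V} (h : MI H G X)
    (hXY : X ⊆ Y) : MI H G Y := by
  obtain ⟨φ, h1, h2, h3, h4⟩ := h
  exact ⟨φ, h1, h2, h3, fun w a ha => hXY (h4 w ha)⟩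

theorem rt_mono {G G' : SimpleGraph V} {S : Set V} {r : V} (hG : G ≤ G') (h : Rt G S r) :
    Rt G' S r :=
  ⟨h.1, fun u hu => rtg_mono (fun _ _ hab => ⟨hG hab.1, hab.2⟩) (h.2 u hu)⟩

theorem MI.mono_graph {H : SimpleGraph W} {G G' : SimpleGraph V} {X : Finset V} (h : MI H G X)
    (hG : G ≤ G') : MI H G' X := by
  obtain ⟨φ, h1, h2, h3, h4⟩ := h
  refine ⟨φ, fun w => ⟨_, rt_mono hG (h1 w).choose_spec⟩, h2, ?_, h4⟩
  intro w1 w2 h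
  obtain ⟨a, ha, b, hb, hab⟩ := h3 h
  exact ⟨a, ha, b, hb, hG hab⟩

theorem rt_singleton (G : SimpleGraph V) (a : V) : Rt G {a} a := by
  refine ⟨rfl, ?_⟩
  rintro u rfl
  exact .refl

theorem rt_pair {G : SimpleGraph V} {a b : V} (h : G.Adj a b) : Rt G {a, b} a := by
  refine ⟨by simp, ?_⟩
  rintro u (rfl | rfl)
  · exact .refl
  · exact .single ⟨h, by simp, by simp⟩

theorem rt_triple {G : SimpleGraph V} {a b c : V} (h : G.Adj a b) (h2 : G.Adj b c) :
    Rt G {a, b, c} a := by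
  refine ⟨by simp, ?_⟩
  have h1 : Relation.ReflTransGen (St G {a, b, c}) a b := .single ⟨h, by simp, by simp⟩
  rintro u (rfl | rfl | rfl)
  · exact .refl
  · exact h1
  · exact h1.tail ⟨h2, by simp, by simp⟩

/-- `x` receives the neighbours of `y` -/
def mg (G : SimpleGraph V) (x y : V) : SimpleGraph V where
  Adj u w := G.Adj u w ∨ (u = x ∧ w ≠ x ∧ G.Adj y w) ∨ (w = x ∧ u ≠ x ∧ G.Adj y u)
  symm := ⟨by
    rintro u w (h | h | h)
    · exact Or.inl h.symm
    · exact Or.inr (Or.inr h)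
    · exact Or.inr (Or.inl h)⟩
  loopless := ⟨by
    rintro u (h | h | h)
    · exact G.loopless.irrefl u h
    · exact h.2.1 h.1
    · exact h.2.1 h.1⟩

theorem merge_minor {H : SimpleGraph W} {G : SimpleGraph V} {X Y P : Finset V} {x y : V}
    (hP : Rt G (P : Set V) x) (hy : y ∈ P) (hPY : P ∩ Y ⊆ {x}) (hPX : P ⊆ X) (hYX : Y ⊆ X)
    (h : MI H (mg G x y) Y) : MI H G X := by
  obtain ⟨φ, h1, h2, h3, h4⟩ := h
  have hPφ : ∀ w u, u ∈ P → u ∈ φ w → u = x := by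
    intro w u hu hw
    have := hPY (mem_inter.2 ⟨hu, h4 w hw⟩)
    simpa using this
  let ψ : W → Set V := fun w => {u | u ∈ φ w ∨ (x ∈ φ w ∧ u ∈ P)}
  have hsub : ∀ w, φ w ⊆ ψ w := fun w u hu => Or.inl hu
  refine ⟨ψ, ?_, ?_, ?_, ?_⟩
  · intro w
    by_cases hx : x ∈ φ w
    · refine ⟨x, hsub w hx, ?_⟩
      have hPr : ∀ u ∈ P, Relation.ReflTransGen (St G (ψ w)) x u := by
        intro u hu
        exact rtg_mono
          (fun a b hab => ⟨hab.1, Or.inr ⟨hx, hab.2.1⟩, Or.inr ⟨hx, hab.2.2⟩⟩) (hP.2 u hu)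
      rintro u (hu | hu)
      · obtain ⟨r, hr⟩ := h1 w
        have := (hr.change hx).2 u hu
        clear hu
        induction this with
        | refl => exact .refl
        | tail _ hs ih =>
          obtain ⟨hadj, ha, hb⟩ := hs
          rcases hadj with h | ⟨h, h', h''⟩ | ⟨h, h', h''⟩
          · exact ih.tail ⟨h, hsub w ha, hsub w hb⟩
          · exact (hPr y hy).tail ⟨h'', Or.inr ⟨hx, hy⟩, hsub w hb⟩
          · rw [h]
      · exact hPr u hu.2
    · obtain ⟨r, hr⟩ := h1 w
      refine ⟨r, hsub w hr.1, ?_⟩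
      rintro u (hu | hu)
      · refine rtg_mono ?_ (hr.2 u hu)
        rintro a b ⟨hadj, ha, hb⟩
        rcases hadj with h | ⟨h, h', h''⟩ | ⟨h, h', h''⟩
        · exact ⟨h, hsub w ha, hsub w hb⟩
        · exact absurd (h ▸ ha) hx
        · exact absurd (h ▸ hb) hx
      · exact absurd hu.1 hx
  · intro w1 w2 hne
    have hd : Disjoint (φ w1) (φ w2) := h2 hne
    show Disjoint (ψ w1) (ψ w2)
    rw [Set.disjoint_left] at hd ⊢
    rintro u (hu | hu) (hu' | hu')
    · exact hd hu hu'
    · have := hPφ w1 u hu'.2 hu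
      subst this
      exact hd hu hu'.1
    · have := hPφ w2 u hu.2 hu'
      subst this
      exact hd hu.1 hu'
    · exact hd hu.1 hu'.1
  · intro w1 w2 hw
    obtain ⟨a, ha, b, hb, hab⟩ := h3 hw
    rcases hab with h | ⟨h, h', h''⟩ | ⟨h, h', h''⟩
    · exact ⟨a, hsub _ ha, b, hsub _ hb, h⟩
    · exact ⟨y, Or.inr ⟨h ▸ ha, hy⟩, b, hsub _ hb, h''⟩
    · exact ⟨a, hsub _ ha, y, Or.inr ⟨h ▸ hb, hy⟩, h''.symm⟩
  · rintro w u (hu | hu)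
    · exact hYX (h4 w hu)
    · exact hPX hu.2

/-- degree into X -/
noncomputable def dg (G : SimpleGraph V) (X : Finset V) (u : V) : ℕ := (X.filter (G.Adj u)).card

/-- twice the number of edges inside X -/
noncomputable def E (G : SimpleGraph V) (X : Finset V) : ℕ := ∑ u ∈ X, dg G X u

theorem dg_erase (G : SimpleGraph V) (X : Finset V) (u v : V) (hv : v ∈ X) :
    dg G X u = dg G (X.erase v) u + if G.Adj u v then 1 else 0 := by
  unfold dg
  rw [filter_erase]
  split_ifs with h
  · rw [card_erase_add_one (by simp [hv, h])]
  · rw [erase_eq_of_notMem (by simp [h])]; rfl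

theorem dg_erase_self (G : SimpleGraph V) (X : Finset V) (v : V) (hv : v ∈ X) :
    dg G X v = dg G (X.erase v) v := by
  rw [dg_erase G X v v hv]; simp

theorem E_erase (G : SimpleGraph V) (X : Finset V) (v : V) (hv : v ∈ X) :
    E G X = E G (X.erase v) + 2 * dg G X v := by
  unfold E
  rw [← add_sum_erase X _ hv]
  rw [sum_congr rfl (fun u _ => dg_erase G X u v hv), sum_add_distrib]
  have : ∑ u ∈ X.erase v, (if G.Adj u v then 1 else 0) = dg G X v := by
    rw [dg_erase_self G X v hv, dg, card_filter]
    exact sum_congr rfl fun u _ => by simp [G.adj_comm]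
  rw [this]; ring

theorem E_eq_card (G : SimpleGraph V) (X : Finset V) :
    E G X = ((X ×ˢ X).filter fun p => G.Adj p.1 p.2).card := by
  unfold E dg
  rw [card_filter, sum_product]
  exact sum_congr rfl fun u _ => by rw [card_filter]

theorem E_congr {G G' : SimpleGraph V} {X : Finset V}
    (h : ∀ u ∈ X, ∀ w ∈ X, G.Adj u w ↔ G'.Adj u w) : E G X = E G' X := by
  unfold E dg
  refine sum_congr rfl fun u hu => ?_
  congr 1
  exact filter_congr fun w hw => h u hu w hw

theorem E_sep {G : SimpleGraph V} {X Y1 Y2 Z : Finset V}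
    (h1 : Z ⊆ Y1) (h2 : Z ⊆ Y2)
    (h : ∀ u ∈ X, ∀ w ∈ X, G.Adj u w → (u ∈ Y1 ∧ w ∈ Y1) ∨ (u ∈ Y2 ∧ w ∈ Y2)) :
    E G X + E G Z ≤ E G Y1 + E G Y2 := by
  simp only [E_eq_card]
  rw [← card_union_add_card_inter ((Y1 ×ˢ Y1).filter _)]
  refine Nat.add_le_add (card_le_card ?_) (card_le_card ?_)
  · rintro ⟨u, w⟩ hp
    simp only [mem_filter, mem_product, mem_union] at hp ⊢
    rcases h u hp.1.1 w hp.1.2 hp.2 with h | h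
    · exact Or.inl ⟨h, hp.2⟩
    · exact Or.inr ⟨h, hp.2⟩
  · rintro ⟨u, w⟩ hp
    simp only [mem_filter, mem_product, mem_inter] at hp ⊢
    exact ⟨⟨⟨h1 hp.1.1, h1 hp.1.2⟩, hp.2⟩, ⟨⟨h2 hp.1.1, h2 hp.1.2⟩, hp.2⟩⟩

/-- codegree -/
noncomputable def cd (G : SimpleGraph V) (X : Finset V) (x y : V) : ℕ :=
  (X.filter fun w => G.Adj x w ∧ G.Adj y w).card

theorem E_merge (G : SimpleGraph V) (X : Finset V) (x y : V) (hx : x ∈ X) (hy : y ∈ X)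
    (hxy : x ≠ y) :
    E G X ≤ E (mg G x y) (X.erase y) + 2 * ((if G.Adj x y then 1 else 0) + cd G X x y) := by
  have hx' : x ∈ X.erase y := mem_erase.2 ⟨hxy, hx⟩
  rw [E_erase G X y hy, E_erase G _ x hx', E_erase (mg G x y) _ x hx']
  have e1 : E G ((X.erase y).erase x) = E (mg G x y) ((X.erase y).erase x) := by
    apply E_congr
    intro u hu w hw
    have hu' : u ≠ x := (mem_erase.1 hu).1
    have hw' : w ≠ x := (mem_erase.1 hw).1
    simp [mg, hu', hw']
  rw [e1]
  have e2 : dg G (X.erase y) x + dg G X y ≤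
      dg (mg G x y) (X.erase y) x + ((if G.Adj x y then 1 else 0) + cd G X x y) := by
    have hA : dg G X y = (((X.erase y).erase x).filter (G.Adj y)).card
        + (if G.Adj x y then 1 else 0) := by
      rw [dg_erase_self G X y hy, dg_erase G _ y x hx', dg]
      simp [G.adj_comm]
    have hB : dg G (X.erase y) x = (((X.erase y).erase x).filter (G.Adj x)).card :=
      dg_erase_self _ _ _ hx'
    have hC : dg (mg G x y) (X.erase y) x
        = ((((X.erase y).erase x).filter (G.Adj x)) ∪
          (((X.erase y).erase x).filter (G.Adj y))).card := by
      rw [dg_erase_self _ _ _ hx', dg, ← filter_or]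
      congr 1
      apply filter_congr
      intro w hw
      have hw' : w ≠ x := (mem_erase.1 hw).1
      simp [mg, hw']
    have hD : ((((X.erase y).erase x).filter (G.Adj x)) ∩
          (((X.erase y).erase x).filter (G.Adj y))).card ≤ cd G X x y := by
      apply card_le_card
      intro w hw
      simp only [mem_inter, mem_filter, mem_erase] at hw ⊢
      exact ⟨hw.1.1.2.2, hw.1.2, hw.2.2⟩
    have := card_union_add_card_inter (((X.erase y).erase x).filter (G.Adj x))
      (((X.erase y).erase x).filter (G.Adj y))
    omega
  omega

/-- there is a vertex of small degree -/
theorem exists_low (G : SimpleGraph V) (X : Finset V) (m : ℕ) (hX : 3 ≤ X.card)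
    (hE : ∀ v ∈ X, E G (X.erase v) + 4 * m ≤ 2 * m * (X.card - 1)) (hm : 0 < m) :
    ∃ v ∈ X, dg G X v < 2 * m := by
  by_contra! hcon
  obtain ⟨v, hv, hmin⟩ := exists_min_image X (dg G X) (card_pos.1 (by omega))
  have h1 := E_erase G X v hv
  have h2 := hE v hv
  have h3 : X.card * dg G X v ≤ E G X := by
    unfold E
    rw [← smul_eq_mul]
    exact card_nsmul_le_sum _ _ _ hmin
  have h4 := hcon v hv
  obtain ⟨n, hn⟩ : ∃ n, X.card = n + 3 := ⟨X.card - 3, by omega⟩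
  rw [hn] at h2 h3
  simp only [show n + 3 - 1 = n + 2 by omega] at h2
  nlinarith [Nat.mul_le_mul_left (n+1) h4]

theorem K5_of {G : SimpleGraph V} {X : Finset V} (φ : Fin 5 → Set V)
    (h1 : ∀ w, ∃ r, Rt G (φ w) r)
    (h2 : ∀ i j, i < j → Disjoint (φ i) (φ j))
    (h3 : ∀ i j, i < j → ∃ a ∈ φ i, ∃ b ∈ φ j, G.Adj a b)
    (h4 : ∀ w, φ w ⊆ (X : Set V)) : MI (SimpleGraph.completeGraph (Fin 5)) G X := by
  refine ⟨φ, h1, ?_, ?_, h4⟩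
  · intro i j hij
    rcases lt_or_gt_of_ne hij with h | h
    · exact h2 i j h
    · exact (h2 j i h).symm
  · intro i j hij
    have hij : i ≠ j := hij
    rcases lt_or_gt_of_ne hij with h | h
    · exact h3 i j h
    · obtain ⟨a, ha, b, hb, hab⟩ := h3 j i h
      exact ⟨b, hb, a, ha, hab.symm⟩

/-- K5 from five vertices-or-pair: branch sets `{x} {p} {a,q} {c} {r}`. -/
theorem K5_of5 {G : SimpleGraph V} {X : Finset V} {x p a q c r : V}
    (hX : x ∈ X ∧ p ∈ X ∧ a ∈ X ∧ q ∈ X ∧ c ∈ X ∧ r ∈ X)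
    (haq : G.Adj a q ∨ a = q) (hxq : x ≠ q) (hpq : p ≠ q) (hcq : c ≠ q) (hrq : r ≠ q)
    (hca : c ≠ a) (hra : r ≠ a)
    (h1 : G.Adj x p) (h2 : G.Adj x a) (h3 : G.Adj x c) (h4 : G.Adj x r)
    (h5 : G.Adj p a) (h6 : G.Adj p c) (h7 : G.Adj p r)
    (h8 : G.Adj q c) (h9 : G.Adj a r) (h10 : G.Adj c r) :
    MI (SimpleGraph.completeGraph (Fin 5)) G X := by
  have e1 := h1.ne
  have e2 := h2.ne
  have e3 := h3.ne
  have e4 := h4.ne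
  have e5 := h5.ne
  have e6 := h6.ne
  have e7 := h7.ne
  have e10 := h10.ne
  obtain ⟨i1, i2, i3, i4, i5, i6⟩ := hX
  refine K5_of ![{x}, {p}, {a, q}, {c}, {r}] ?_ ?_ ?_ ?_
  · intro w
    fin_cases w
    · exact ⟨_, rt_singleton G x⟩
    · exact ⟨_, rt_singleton G p⟩
    · refine ⟨a, ?_⟩
      rcases haq with h | h
      · exact rt_pair h
      · subst h
        simpa using rt_singleton G a
    · exact ⟨_, rt_singleton G c⟩
    · exact ⟨_, rt_singleton G r⟩
  · intro i j hij
    fin_cases i <;> fin_cases j <;> first | (exfalso; revert hij; decide) | skip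
    all_goals simp [Set.disjoint_left]
    all_goals grind
  · intro i j hij
    fin_cases i <;> fin_cases j <;> first | (exfalso; revert hij; decide) | skip
    all_goals simp
    all_goals grind [SimpleGraph.adj_comm]
  · intro w
    fin_cases w <;> simp [Set.insert_subset_iff, *]

theorem E_le_sq (G : SimpleGraph V) (X : Finset V) : E G X ≤ X.card * (X.card - 1) := by
  unfold E
  rw [← smul_eq_mul]
  apply sum_le_card_nsmul
  intro u hu
  rw [dg_erase_self G X u hu, ← card_erase_of_mem hu]
  exact card_filter_le _ _

theorem boundA (n : ℕ) : ∀ (X : Finset V) (G : SimpleGraph V), X.card = n → 3 ≤ n →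
    ¬ MI (SimpleGraph.completeGraph (Fin 5)) G X → E G X + 12 ≤ 6 * n := by
  induction n using Nat.strong_induction_on with
  | _ n ih =>
  intro X G hXn hn hK
  by_contra! hlt
  have hn4 : 4 ≤ n := by
    by_contra! h
    have : n = 3 := by omega
    have := E_le_sq G X
    rw [hXn, ‹n = 3›] at this
    omega
  have hdel : ∀ v ∈ X, E G (X.erase v) + 12 ≤ 6 * (n - 1) := fun v hv =>
    ih (n-1) (by omega) _ G (by rw [card_erase_of_mem hv, hXn]) (by omega)
      (fun h => hK (h.mono (erase_subset _ _)))
  obtain ⟨x, hx, hxd⟩ := exists_low G X 3 (by omega)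
    (fun v hv => by have := hdel v hv; rw [hXn]; omega) (by omega)
  have hxd4 : 4 ≤ dg G X x := by
    have := hdel x hx
    have := E_erase G X x hx
    omega
  have hcd : ∀ y ∈ X, G.Adj x y → 3 ≤ cd G X x y := by
    intro y hy hxy
    by_contra! hc
    have h1 := E_merge G X x y hx hy hxy.ne
    have h2 := ih (n-1) (by omega) (X.erase y) (mg G x y)
      (by rw [card_erase_of_mem hy, hXn]) (by omega) (fun h => hK (by
        refine merge_minor (P := {x, y}) (x := x) (y := y) (by simpa using rt_pair hxy)
          (by simp) ?_ ?_ (erase_subset _ _) h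
        · intro u hu; simp at hu ⊢; tauto
        · intro u hu; simp at hu; rcases hu with rfl | rfl <;> assumption))
    simp only [hxy, if_true] at h1
    omega
  set N := X.filter (G.Adj x) with hN
  have hNd : N.card = dg G X x := rfl
  have hmem : ∀ u, u ∈ N ↔ u ∈ X ∧ G.Adj x u := by intro u; simp [hN]
  -- each y in N has at most one non-neighbour in N besides itself
  have hcd' : ∀ y ∈ N, 3 ≤ (N.filter (G.Adj y)).card := by
    intro y hy
    have := hcd y ((hmem y).1 hy).1 ((hmem y).1 hy).2
    rwa [cd, ← filter_filter] at this
  have hnon : ∀ y ∈ N, ∀ a ∈ N, ∀ b ∈ N, a ≠ y → b ≠ y → a ≠ b → ¬ G.Adj y a → G.Adj y b := by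
    intro y hy a ha b hb hay hby hab hya
    by_contra hyb
    have h1 : N.filter (G.Adj y) ⊆ ((N.erase y).erase a).erase b := by
      intro u hu
      simp only [mem_filter] at hu
      simp only [mem_erase]
      refine ⟨?_, ?_, ?_, hu.1⟩
      · rintro rfl; exact hyb hu.2
      · rintro rfl; exact hya hu.2
      · rintro rfl; exact G.loopless.irrefl _ hu.2
    have h2 := card_le_card h1
    rw [card_erase_of_mem (mem_erase.2 ⟨hab.symm, mem_erase.2 ⟨hby, hb⟩⟩),
      card_erase_of_mem (mem_erase.2 ⟨hay, ha⟩),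
      card_erase_of_mem hy] at h2
    have := hcd' y hy
    omega
  by_cases hcl : ∀ a ∈ N, ∀ b ∈ N, a ≠ b → G.Adj a b
  · obtain ⟨T, hT, hT4⟩ := exists_subset_card_eq (hNd ▸ hxd4 : 4 ≤ N.card)
    obtain ⟨p, a, c, r, h1, h2, h3, h4, h5, h6, rfl⟩ := card_eq_four.1 hT4
    have hp := hT (show p ∈ _ by simp)
    have ha := hT (show a ∈ _ by simp)
    have hc := hT (show c ∈ _ by simp)
    have hr := hT (show r ∈ _ by simp)
    have hp' := (hmem _).1 hp
    have ha' := (hmem _).1 ha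
    have hc' := (hmem _).1 hc
    have hr' := (hmem _).1 hr
    exact hK (K5_of5 (x := x) (p := p) (a := a) (q := a) (c := c) (r := r)
      ⟨hx, hp'.1, ha'.1, ha'.1, hc'.1, hr'.1⟩ (Or.inr rfl) ha'.2.ne h1 h4.symm h5.symm h4.symm
      h5.symm hp'.2 ha'.2 hc'.2 hr'.2 (hcl _ hp _ ha h1) (hcl _ hp _ hc h2) (hcl _ hp _ hr h3)
      (hcl _ ha _ hc h4) (hcl _ ha _ hr h5) (hcl _ hc _ hr h6))
  · push Not at hcl
    obtain ⟨a, ha, c, hc, hac, hnac⟩ := hcl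
    have hM : 2 < ((N.erase a).erase c).card := by
      have h1 : N.filter (G.Adj a) ⊆ (N.erase a).erase c := by
        intro u hu
        simp only [mem_filter] at hu
        simp only [mem_erase]
        refine ⟨?_, ?_, hu.1⟩
        · rintro rfl; exact hnac hu.2
        · rintro rfl; exact G.loopless.irrefl _ hu.2
      have := card_le_card h1
      have := hcd' a ha
      omega
    obtain ⟨p, q, r, hp, hq, hr, hpq, hpr, hqr⟩ := two_lt_card_iff.1 hM
    simp only [mem_erase] at hp hq hr
    obtain ⟨hpc, hpa, hp⟩ := hp
    obtain ⟨hqc, hqa, hq⟩ := hq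
    obtain ⟨hrc, hra, hr⟩ := hr
    have A1 : ∀ u ∈ N, u ≠ a → u ≠ c → G.Adj a u := fun u hu h h' =>
      hnon a ha c hc u hu hac.symm h h'.symm hnac
    have A2 : ∀ u ∈ N, u ≠ a → u ≠ c → G.Adj c u := fun u hu h h' =>
      hnon c hc a ha u hu hac h' h.symm (fun h => hnac h.symm)
    have fin : ∀ p q r, p ∈ N → q ∈ N → r ∈ N → p ≠ a → p ≠ c → q ≠ a → q ≠ c → r ≠ a → r ≠ c →
        p ≠ q → p ≠ r → q ≠ r → G.Adj p r → False := by
      intro p q r hp hq hr hpa hpc hqa hqc hra hrc hpq hpr hqr hadj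
      have hp' := (hmem _).1 hp
      have hq' := (hmem _).1 hq
      have ha' := (hmem _).1 ha
      have hc' := (hmem _).1 hc
      have hr' := (hmem _).1 hr
      exact hK (K5_of5 (x := x) (p := p) (a := a) (q := q) (c := c) (r := r)
        ⟨hx, hp'.1, ha'.1, hq'.1, hc'.1, hr'.1⟩ (Or.inl (A1 q hq hqa hqc)) hq'.2.ne hpq hqc.symm
        hqr.symm hac.symm hra hp'.2 ha'.2 hc'.2 hr'.2 (A1 p hp hpa hpc).symm
        (A2 p hp hpa hpc).symm hadj
        (A2 q hq hqa hqc).symm (A1 r hr hra hrc) (A2 r hr hra hrc))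
    by_cases h : G.Adj p r
    · exact fin p q r hp hq hr hpa hpc hqa hqc hra hrc hpq hpr hqr h
    · exact fin p r q hp hr hq hpa hpc hra hrc hqa hqc hpr hpq hqr.symm
        (hnon p hp r hr q hq hpr.symm hpq.symm hqr.symm h)

theorem K33_of {G : SimpleGraph V} {X C : Finset V} {a b v p q c : V}
    (hC : Rt G (C : Set V) c) (hCX : C ⊆ X)
    (hX : a ∈ X ∧ b ∈ X ∧ v ∈ X ∧ p ∈ X ∧ q ∈ X)
    (hab : a ≠ b) (hvp : v ≠ p) (hvq : v ≠ q) (hpq : p ≠ q)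
    (haC : a ∉ C) (hbC : b ∉ C) (hvC : v ∉ C) (hpC : p ∉ C) (hqC : q ∉ C)
    (h1 : G.Adj a v) (h2 : G.Adj a p) (h3 : G.Adj a q)
    (h4 : G.Adj b v) (h5 : G.Adj b p) (h6 : G.Adj b q)
    (h7 : ∃ u ∈ C, G.Adj u v) (h8 : ∃ u ∈ C, G.Adj u p) (h9 : ∃ u ∈ C, G.Adj u q) :
    MI (completeBipartiteGraph (Fin 3) (Fin 3)) G X := by
  have e1 := h1.ne
  have e2 := h2.ne
  have e3 := h3.ne
  have e4 := h4.ne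
  have e5 := h5.ne
  have e6 := h6.ne
  obtain ⟨i1, i2, i3, i4, i5⟩ := hX
  have key : ∀ i j : Fin 3, ∃ x ∈ (![{a}, {b}, (C : Set V)] : Fin 3 → Set V) i,
      ∃ y ∈ (![{v}, {p}, {q}] : Fin 3 → Set V) j, G.Adj x y := by
    intro i j
    fin_cases i <;> fin_cases j <;> simpa
  refine ⟨Sum.elim ![{a}, {b}, (C : Set V)] ![{v}, {p}, {q}], ?_, ?_, ?_, ?_⟩
  · rintro (w | w) <;> fin_cases w
    · exact ⟨_, rt_singleton G a⟩
    · exact ⟨_, rt_singleton G b⟩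
    · exact ⟨_, hC⟩
    · exact ⟨_, rt_singleton G v⟩
    · exact ⟨_, rt_singleton G p⟩
    · exact ⟨_, rt_singleton G q⟩
  · rintro (i | i) (j | j) hij <;> fin_cases i <;> fin_cases j <;>
      first | (exfalso; exact hij rfl) | skip
    all_goals simp
    all_goals first | assumption | (apply Ne.symm; assumption)
  · rintro (i | i) (j | j) hij
    · simp at hij
    · exact key i j
    · obtain ⟨x, hx, y, hy, hxy⟩ := key j i
      exact ⟨y, hy, x, hx, hxy.symm⟩
    · simp at hij
  · rintro (w | w) <;> fin_cases w <;> simp [*]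

set_option maxHeartbeats 4000000 in
theorem boundB (n : ℕ) : ∀ (X : Finset V) (G : SimpleGraph V) (col : V → Bool), X.card = n →
    3 ≤ n → (∀ u w, G.Adj u w → col u ≠ col w) →
    ¬ MI (completeBipartiteGraph (Fin 3) (Fin 3)) G X → E G X + 8 ≤ 4 * n := by
  induction n using Nat.strong_induction_on with
  | _ n ih =>
  intro X G col hXn hn hcol hK
  by_contra! hlt
  have hn4 : 4 ≤ n := by
    by_contra! h
    have h3 : n = 3 := by omega
    obtain ⟨u, hu, w, hw, huw, hcuw⟩ := exists_ne_map_eq_of_card_lt_of_maps_to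
      (s := X) (t := (univ : Finset Bool)) (f := col) (by simp [hXn, h3]) (fun _ _ => by simp)
    have hd : dg G X u ≤ 1 := by
      have h1 : X.filter (G.Adj u) ⊆ (X.erase u).erase w := by
        intro z hz
        simp only [mem_filter] at hz
        simp only [mem_erase]
        refine ⟨?_, ?_, hz.1⟩
        · rintro rfl; exact hcol _ _ hz.2 hcuw
        · rintro rfl; exact G.loopless.irrefl _ hz.2
      have := card_le_card h1
      rw [card_erase_of_mem (mem_erase.2 ⟨huw.symm, hw⟩), card_erase_of_mem hu] at this
      unfold dg
      omega
    have h1 := E_erase G X u hu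
    have h2 := E_le_sq G (X.erase u)
    rw [card_erase_of_mem hu, hXn, h3] at h2
    omega
  have hdel : ∀ v ∈ X, E G (X.erase v) + 8 ≤ 4 * (n - 1) := fun v hv =>
    ih (n-1) (by omega) _ G col (by rw [card_erase_of_mem hv, hXn]) (by omega) hcol
      (fun h => hK (h.mono (erase_subset _ _)))
  obtain ⟨v, hv, hvd⟩ := exists_low G X 2 (by omega)
    (fun v hv => by have := hdel v hv; rw [hXn]; omega) (by omega)
  have hd3 : ∀ x ∈ X, 3 ≤ dg G X x := by
    intro x hx
    have := hdel x hx
    have := E_erase G X x hx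
    omega
  have hv3 : (X.filter (G.Adj v)).card = 3 := by
    have := hd3 v hv
    unfold dg at *
    omega
  obtain ⟨a, b, c, hab, hac, hbc, hN⟩ := card_eq_three.1 hv3
  have hmem : ∀ u, (u ∈ X ∧ G.Adj v u) ↔ (u = a ∨ u = b ∨ u = c) := by
    intro u
    have : u ∈ X.filter (G.Adj v) ↔ u ∈ ({a, b, c} : Finset V) := by rw [hN]
    simpa using this
  obtain ⟨haX, hva⟩ := (hmem a).2 (by simp)
  obtain ⟨hbX, hvb⟩ := (hmem b).2 (by simp)
  obtain ⟨hcX, hvc⟩ := (hmem c).2 (by simp)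
  have cne : ∀ x y z, G.Adj x y → G.Adj x z → col y = col z := by
    intro x y z h1 h2
    have := hcol _ _ h1
    have := hcol _ _ h2
    revert this
    revert this
    cases col x <;> cases col y <;> cases col z <;> simp
  have cab : col a = col b := cne v a b hva hvb
  have cac : col a = col c := cne v a c hva hvc
  have hn5 : 5 ≤ n := by
    have h1 : ({a, b} : Finset V) ∪ X.filter (G.Adj a) ⊆ X := by
      intro u hu
      simp at hu
      rcases hu with rfl | rfl | hu
      · exact haX
      · exact hbX
      · exact hu.1
    have h2 := card_le_card h1
    rw [card_union_of_disjoint, card_pair hab] at h2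
    · have := hd3 a haX
      unfold dg at this
      omega
    · rw [disjoint_left]
      intro u hu hu'
      simp at hu hu'
      rcases hu with rfl | rfl
      · exact G.loopless.irrefl _ hu'.2
      · exact hcol _ _ hu'.2 cab
  have hnab : ¬ G.Adj a b := fun h => hcol _ _ h cab
  have hcd : 2 ≤ cd G (X.erase v) a b := by
    by_contra! hlt2
    have h0 := E_erase G X v hv
    have haX' : a ∈ X.erase v := mem_erase.2 ⟨hva.ne.symm, haX⟩
    have hbX' : b ∈ X.erase v := mem_erase.2 ⟨hvb.ne.symm, hbX⟩
    have h1 := E_merge G (X.erase v) a b haX' hbX' hab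
    have h2 := ih (n-2) (by omega) ((X.erase v).erase b) (mg G a b) col
      (by rw [card_erase_of_mem hbX', card_erase_of_mem hv, hXn]; omega) (by omega) (by
        rintro u w (h | ⟨rfl, _, h⟩ | ⟨rfl, _, h⟩)
        · exact hcol _ _ h
        · rw [cab]; exact hcol _ _ h
        · rw [cab]; exact (hcol _ _ h).symm) (fun h => hK (by
        refine merge_minor (P := {a, v, b}) (x := a) (y := b)
          (by simpa using rt_triple hva.symm hvb)
          (by simp) ?_ ?_ ((erase_subset _ _).trans (erase_subset _ _)) h
        · intro u hu; simp at hu ⊢; tauto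
        · intro u hu; simp at hu; rcases hu with rfl | rfl | rfl <;> assumption))
    simp only [hnab, if_false] at h1
    have : dg G X v = 3 := hv3
    omega
  obtain ⟨p, q, hp, hq, hpq⟩ := one_lt_card_iff.1 hcd
  simp only [mem_filter, mem_erase] at hp hq
  have claim : ∀ (p q : V) (C : Finset V), p ∈ X → q ∈ X → p ≠ v → q ≠ v → p ≠ q →
      G.Adj a p → G.Adj b p → G.Adj a q → G.Adj b q → C ⊆ X → c ∈ C →
      a ∉ C → b ∉ C → v ∉ C → p ∉ C → q ∉ C →
      (∀ u ∈ C, ∀ w ∈ X, G.Adj u w → w ∈ C ∨ w = a ∨ w = b ∨ w = v ∨ w = p ∨ w = q) →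
      (∀ u ∈ C, ¬ G.Adj u q) → False := by
    intro p q C hp hq hpv hqv hpq hap hbp haq hbq hCX hcC haC hbC hvC hpC hqC hcl hno
    obtain ⟨d, hdX, hqd, hda, hdb⟩ : ∃ d ∈ X, G.Adj q d ∧ d ≠ a ∧ d ≠ b := by
      by_contra! hcon
      have h1 : X.filter (G.Adj q) ⊆ {a, b} := by
        intro u hu
        simp only [mem_filter] at hu
        have := hcon u hu.1 hu.2
        simp only [mem_insert, mem_singleton]
        tauto
      have h2 := card_le_card h1
      rw [card_pair hab] at h2
      have := hd3 q hq
      unfold dg at this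
      omega
    have hdC : d ∉ C := fun h => hno d h hqd.symm
    have cda : col d = col a := cne q d a hqd haq.symm
    have hdv : d ≠ v := by rintro rfl; exact hcol _ _ hva cda
    have hdp : d ≠ p := by rintro rfl; exact hcol _ _ hap cda.symm
    have hdq : d ≠ q := by rintro rfl; exact hcol _ _ haq cda.symm
    have hZ : ({a, b, p, q} : Finset V).card = 4 := by
      rw [card_eq_four]
      exact ⟨a, b, p, q, hab, hap.ne, haq.ne, hbp.ne, hbq.ne, hpq, rfl⟩
    have hZE : 8 ≤ E G {a, b, p, q} := by
      have : ({a, b, p, q} : Finset V).card • 2 ≤ E G {a, b, p, q} := by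
        unfold E
        apply card_nsmul_le_sum
        intro u hu
        have h1 : ({p, q} : Finset V) ⊆ ({a, b, p, q} : Finset V).filter (G.Adj u) ∨
            ({a, b} : Finset V) ⊆ ({a, b, p, q} : Finset V).filter (G.Adj u) := by
          simp only [mem_insert, mem_singleton] at hu
          rcases hu with rfl | rfl | rfl | rfl
          · left; intro z hz; simp at hz ⊢; rcases hz with rfl | rfl <;> simp [*]
          · left; intro z hz; simp at hz ⊢; rcases hz with rfl | rfl <;> simp [*]
          · right; intro z hz; simp at hz ⊢; rcases hz with rfl | rfl <;> simp [*, SimpleGraph.Adj.symm]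
          · right; intro z hz; simp at hz ⊢; rcases hz with rfl | rfl <;> simp [*, SimpleGraph.Adj.symm]
        rcases h1 with h1 | h1
        · have := card_le_card h1
          rwa [card_pair hpq] at this
        · have := card_le_card h1
          rwa [card_pair hab] at this
      rw [hZ] at this
      simpa using this
    have hDX : insert v C ⊆ X := insert_subset hv hCX
    have hZX : ({a, b, p, q} : Finset V) ⊆ X := by
      intro u hu
      simp at hu
      rcases hu with rfl | rfl | rfl | rfl <;> assumption
    have hdisj : Disjoint (insert v C) ({a, b, p, q} : Finset V) := by
      rw [disjoint_right]
      intro u hu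
      simp only [mem_insert, mem_singleton] at hu ⊢
      rcases hu with rfl | rfl | rfl | rfl
      · have := hva.ne; rintro (h | h) <;> tauto
      · have := hvb.ne; rintro (h | h) <;> tauto
      · rintro (h | h) <;> tauto
      · rintro (h | h) <;> tauto
    have hsep := E_sep (G := G) (X := X) (Y1 := insert v C ∪ {a, b, p, q}) (Y2 := X \ insert v C)
      (Z := {a, b, p, q}) subset_union_right
      (fun u hu => mem_sdiff.2 ⟨hZX hu, fun h => disjoint_left.1 hdisj h hu⟩) (by
        have aux : ∀ u ∈ insert v C, ∀ w ∈ X, G.Adj u w →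
            u ∈ insert v C ∪ {a, b, p, q} ∧ w ∈ insert v C ∪ {a, b, p, q} := by
          intro u hu w hw huw
          refine ⟨mem_union_left _ hu, ?_⟩
          rcases mem_insert.1 hu with rfl | hu
          · have := (hmem w).1 ⟨hw, huw⟩
            simp only [mem_union, mem_insert, mem_singleton]
            rcases this with rfl | rfl | rfl <;> tauto
          · have := hcl u hu w hw huw
            simp only [mem_union, mem_insert, mem_singleton]
            tauto
        intro u hu w hw huw
        by_cases h1 : u ∈ insert v C
        · exact Or.inl (aux u h1 w hw huw)
        by_cases h2 : w ∈ insert v C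
        · exact Or.inl (aux w h2 u hu huw.symm).symm
        exact Or.inr ⟨mem_sdiff.2 ⟨hu, h1⟩, mem_sdiff.2 ⟨hw, h2⟩⟩)
    have hc1 : (insert v C ∪ {a, b, p, q}).card = (insert v C).card + 4 := by
      rw [card_union_of_disjoint hdisj, hZ]
    have hc2 : (X \ insert v C).card + (insert v C).card = n := by
      rw [card_sdiff_add_card_eq_card hDX, hXn]
    have hc3 : (insert v C ∪ {a, b, p, q}).card < n := by
      rw [← hXn]
      apply card_lt_card
      refine ⟨union_subset hDX hZX, fun h => ?_⟩
      have := h hdX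
      simp only [mem_union, mem_insert, mem_singleton] at this
      tauto
    have hc4 : 0 < (insert v C).card := card_pos.2 ⟨v, by simp⟩
    have r1 := ih _ hc3 _ G col rfl (by omega) hcol
      (fun h => hK (h.mono (union_subset hDX hZX)))
    have r2 := ih (X \ insert v C).card (by omega) _ G col rfl (by omega) hcol
      (fun h => hK (h.mono sdiff_subset))
    omega
  obtain ⟨⟨hpv, hpX⟩, hap, hbp⟩ := hp
  obtain ⟨⟨hqv, hqX⟩, haq, hbq⟩ := hq
  set T : Finset V := X \ {a, b, v, p, q} with hT
  have hcT : c ∈ T := by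
    simp only [hT, mem_sdiff, mem_insert, mem_singleton]
    refine ⟨hcX, ?_⟩
    rintro (h | h | h | h | h)
    · exact hac h.symm
    · exact hbc h.symm
    · exact hvc.ne h.symm
    · subst h; exact hcol _ _ hap cac
    · subst h; exact hcol _ _ haq cac
  set C : Finset V := T.filter fun u => Relation.ReflTransGen (St G (T : Set V)) c u with hCdef
  have hCT : ∀ u ∈ C, u ∈ T := fun u hu => (mem_filter.1 hu).1
  have hTn : ∀ u ∈ T, u ∈ X ∧ u ≠ a ∧ u ≠ b ∧ u ≠ v ∧ u ≠ p ∧ u ≠ q := by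
    intro u hu
    simp only [hT, mem_sdiff, mem_insert, mem_singleton] at hu
    tauto
  have hcC : c ∈ C := mem_filter.2 ⟨hcT, .refl⟩
  have hRt : Rt G (C : Set V) c := by
    refine ⟨hcC, ?_⟩
    intro u hu
    have h := (mem_filter.1 (mem_coe.1 hu)).2
    clear hu
    induction h with
    | refl => exact .refl
    | @tail x y h1 h2 ih =>
      refine ih.tail ⟨h2.1, ?_, ?_⟩
      · exact mem_coe.2 (mem_filter.2 ⟨h2.2.1, h1⟩)
      · exact mem_coe.2 (mem_filter.2 ⟨h2.2.2, h1.tail h2⟩)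
  have hCX : C ⊆ X := fun u hu => (hTn u (hCT u hu)).1
  have haC : a ∉ C := fun h => (hTn _ (hCT _ h)).2.1 rfl
  have hbC : b ∉ C := fun h => (hTn _ (hCT _ h)).2.2.1 rfl
  have hvC : v ∉ C := fun h => (hTn _ (hCT _ h)).2.2.2.1 rfl
  have hpC : p ∉ C := fun h => (hTn _ (hCT _ h)).2.2.2.2.1 rfl
  have hqC : q ∉ C := fun h => (hTn _ (hCT _ h)).2.2.2.2.2 rfl
  have hcl : ∀ u ∈ C, ∀ w ∈ X, G.Adj u w →
      w ∈ C ∨ w = a ∨ w = b ∨ w = v ∨ w = p ∨ w = q := by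
    intro u hu w hw huw
    by_cases hwT : w ∈ T
    · left
      exact mem_filter.2 ⟨hwT, (mem_filter.1 hu).2.tail ⟨huw, hCT u hu, hwT⟩⟩
    · right
      by_contra hcon
      apply hwT
      simp only [hT, mem_sdiff, mem_insert, mem_singleton]
      exact ⟨hw, hcon⟩
  by_cases hq' : ∃ u ∈ C, G.Adj u q
  · by_cases hp' : ∃ u ∈ C, G.Adj u p
    · exact hK (K33_of hRt hCX ⟨haX, hbX, hv, hpX, hqX⟩ hab hpv.symm hqv.symm hpq haC hbC hvC hpC
        hqC hva.symm hap haq hvb.symm hbp hbq ⟨c, hcC, hvc.symm⟩ hp' hq')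
    · push Not at hp'
      exact claim q p C hqX hpX hqv hpv hpq.symm haq hbq hap hbp hCX hcC haC hbC hvC hqC hpC
        (fun u hu w hw h => by have := hcl u hu w hw h; tauto) hp'
  · push Not at hq'
    exact claim p q C hpX hqX hpv hqv hpq hap hbp haq hbq hCX hcC haC hbC hvC hpC hqC hcl hq'

/-- the bipartite subgraph between S and its complement -/
def cut (G : SimpleGraph V) (S : Finset V) : SimpleGraph V where
  Adj u w := G.Adj u w ∧ ¬ (u ∈ S ↔ w ∈ S)
  symm := ⟨fun u w h => ⟨h.1.symm, fun h' => h.2 h'.symm⟩⟩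
  loopless := ⟨fun u h => h.2 Iff.rfl⟩

theorem main [Fintype V] (G : SimpleGraph V) (hG : G.IsPlanar) (S : Finset V) (hk : 3 ≤ S.card) :
    ∑ v ∈ S, dg G univ v + 16 ≤ 2 * Fintype.card V + 6 * S.card := by
  have hA := boundA S.card S G rfl hk (fun h => hG.1 h.isMinor)
  have hn : 3 ≤ (univ : Finset V).card := hk.trans (card_le_card (subset_univ _))
  have hB := boundB _ univ (cut G S) (fun u => decide (u ∈ S)) rfl hn
    (fun u w h h' => h.2 (by simpa using h'))
    (fun h => hG.2 (h.mono_graph (G' := G) (fun u w h => h.1)).isMinor)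
  rw [card_univ] at hB
  have h1 : ∀ v ∈ S, dg G univ v = dg G S v + (Sᶜ.filter (G.Adj v)).card := by
    intro v hv
    unfold dg
    rw [← card_union_of_disjoint, ← filter_union, union_compl]
    exact disjoint_filter_filter disjoint_compl_right
  have h2 : ∀ v ∈ S, dg (cut G S) univ v = (Sᶜ.filter (G.Adj v)).card := by
    intro v hv
    unfold dg
    congr 1
    ext w
    simp [cut, hv, and_comm]
  have h3 : ∀ v ∈ Sᶜ, dg (cut G S) univ v = (S.filter (G.Adj v)).card := by
    intro v hv
    unfold dg
    congr 1
    ext w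
    simp at hv
    simp [cut, hv, and_comm]
  have h4 : ∑ v ∈ Sᶜ, (S.filter (G.Adj v)).card = ∑ v ∈ S, (Sᶜ.filter (G.Adj v)).card := by
    simp only [card_filter]
    rw [sum_comm]
    simp only [G.adj_comm]
  have h5 : E (cut G S) univ = 2 * ∑ v ∈ S, (Sᶜ.filter (G.Adj v)).card := by
    unfold E
    rw [← sum_add_sum_compl S, sum_congr rfl h2, sum_congr rfl h3, h4]
    ring
  rw [sum_congr rfl h1, sum_add_distrib]
  have h6 : ∑ v ∈ S, dg G S v = E G S := rfl
  omega

end PlanarAux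

/-- If `G` is a planar graph on `n ≥ 3` vertices and `S` is a set of `k ≥ 3` vertices,
then the sum of the degrees (in `G`) of the vertices in `S` is at most `2n + 6k - 16`. -/
theorem stmt_1 {V : Type*} [Fintype V] [DecidableEq V] (G : SimpleGraph V)
    [DecidableRel G.Adj] (hplanar : G.IsPlanar) (hn : 3 ≤ Fintype.card V)
    (S : Finset V) (k : ℕ) (hS : S.card = k) (hk : 3 ≤ k) :
    (∑ v ∈ S, (G.degree v : ℤ)) ≤ 2 * (Fintype.card V : ℤ) + 6 * k - 16 := by
  subst hS
  have h := PlanarAux.main G hplanar S hk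
  have h2 : ∀ v, PlanarAux.dg G Finset.univ v = G.degree v := by
    intro v
    rw [← SimpleGraph.card_neighborFinset_eq_degree]
    unfold PlanarAux.dg
    congr 1
    ext w
    simp
  simp only [h2] at h
  have h3 : ((∑ v ∈ S, G.degree v : ℕ) : ℤ) + 16 ≤ 2 * (Fintype.card V : ℤ) + 6 * S.card := by
    exact_mod_cast h
  push_cast at h3
  linarith
end

section
/- There exists a constant C such that every planar graph on n vertices contains at most n³ + C·n² paths of length 4. Moreover, for each n there is an n-vertex planar graph containing at least n³ − C·n² paths of length 4 (e.g., a path on n − 2 vertices with two additional adjacent vertices each joined to all path vertices), so the maximum number of paths of length 4 in an n-vertex planar graph equals n³ + O(n²). -/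
/-- The number of (unordered) paths of length 4 in an `n`-vertex planar graph, counted
via walks which are paths of length 4 (each unordered path corresponds to exactly two
such walks, whence the division by 2). -/
noncomputable def numP4 (n : ℕ) (G : SimpleGraph (Fin n)) : ℝ :=
  (Nat.card {p : Σ u v : Fin n, G.Walk u v // p.2.2.IsPath ∧ p.2.2.length = 4} : ℝ) / 2

open Classical in
/-- ordered edge count inside `X` -/
noncomputable def eCnt {V : Type} (G : SimpleGraph V) (X : Finset V) : ℕ :=
  ∑ x ∈ X, ∑ y ∈ X, if G.Adj x y then 1 else 0

def ConnIn {V : Type} (G : SimpleGraph V) (s : Set V) : Prop :=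
  ∀ x ∈ s, ∀ y ∈ s, Relation.ReflTransGen (fun a b => G.Adj a b ∧ a ∈ s ∧ b ∈ s) x y

lemma ConnIn.connected {V : Type} {G : SimpleGraph V} {s : Set V} (h : ConnIn G s)
    (hne : s.Nonempty) : (G.induce s).Connected := by
  obtain ⟨x0, hx0⟩ := hne
  have : Nonempty s := ⟨⟨x0, hx0⟩⟩
  refine SimpleGraph.Connected.mk ?_
  rintro ⟨x, hx⟩ ⟨y, hy⟩
  have key : ∀ z, Relation.ReflTransGen (fun a b => G.Adj a b ∧ a ∈ s ∧ b ∈ s) x z →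
      ∀ hz : z ∈ s, (G.induce s).Reachable ⟨x, hx⟩ ⟨z, hz⟩ := by
    intro z hz
    induction hz with
    | refl => intro _; exact SimpleGraph.Reachable.refl _
    | tail _ hbc ih =>
      intro hz
      refine (ih hbc.2.1).trans (SimpleGraph.Adj.reachable ?_)
      simpa using hbc.1
  exact key y (h x hx y hy) hy

def KMinorIn {V : Type} (r : ℕ) (G : SimpleGraph V) (X : Finset V) : Prop :=
  ∃ φ : Fin r → Set V, (∀ i, (φ i).Nonempty) ∧ (∀ i, φ i ⊆ X) ∧ (∀ i, ConnIn G (φ i)) ∧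
    (∀ i j, i ≠ j → Disjoint (φ i) (φ j)) ∧
    ∀ i j, i ≠ j → ∃ a ∈ φ i, ∃ b ∈ φ j, G.Adj a b

lemma connIn_singleton {V : Type} (G : SimpleGraph V) (v : V) : ConnIn G {v} := by
  rintro x rfl y rfl
  exact Relation.ReflTransGen.refl

def contr {V : Type} (G : SimpleGraph V) (u v : V) : SimpleGraph V where
  Adj x y := x ≠ y ∧ x ≠ v ∧ y ≠ v ∧ (G.Adj x y ∨ (x = u ∧ G.Adj v y) ∨ (y = u ∧ G.Adj v x))
  symm := ⟨by
    rintro x y ⟨h1, h2, h3, h4⟩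
    refine ⟨h1.symm, h3, h2, ?_⟩
    rcases h4 with h | h | h
    · exact Or.inl h.symm
    · exact Or.inr (Or.inr h)
    · exact Or.inr (Or.inl h)⟩
  loopless := ⟨fun x h => h.1 rfl⟩

lemma KMinorIn.lift {V : Type} [DecidableEq V] {r : ℕ} {G : SimpleGraph V} {u v : V}
    {X : Finset V}
    (huv : G.Adj u v) (hv : v ∈ X) (h : KMinorIn r (contr G u v) (X.erase v)) :
    KMinorIn r G X := by
  obtain ⟨φ, h1, h2, h3, h4, h5⟩ := h
  have hvn : ∀ i, v ∉ φ i := fun i hi => by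
    have := h2 i hi
    simp at this
  let ψ : Fin r → Set V := fun i => {x | x ∈ φ i ∨ (x = v ∧ u ∈ φ i)}
  have hsub : ∀ i x, x ∈ φ i → x ∈ ψ i := fun i x hx => Or.inl hx
  refine ⟨ψ, fun i => (h1 i).mono (hsub i), ?_, ?_, ?_, ?_⟩
  · rintro i x (hx | ⟨rfl, -⟩)
    · have := h2 i hx
      exact Finset.mem_coe.2 (Finset.mem_of_mem_erase (Finset.mem_coe.1 this))
    · simpa using hv
  · intro i
    set R : V → V → Prop := fun a b => G.Adj a b ∧ a ∈ ψ i ∧ b ∈ ψ i with hR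
    have hRs : ∀ a b, R a b → R b a := fun a b h => ⟨h.1.symm, h.2.2, h.2.1⟩
    have hsymm : ∀ a b, Relation.ReflTransGen R a b → Relation.ReflTransGen R b a := by
      intro a b hab
      induction hab with
      | refl => exact Relation.ReflTransGen.refl
      | tail _ hbc ih => exact Relation.ReflTransGen.head (hRs _ _ hbc) ih
    have huvR : u ∈ φ i → R u v := fun hu => ⟨huv, Or.inl hu, Or.inr ⟨rfl, hu⟩⟩
    have step : ∀ a b, ((contr G u v).Adj a b ∧ a ∈ φ i ∧ b ∈ φ i) →
        Relation.ReflTransGen R a b := by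
      rintro a b ⟨⟨_, _, _, hab | ⟨rfl, hab⟩ | ⟨rfl, hab⟩⟩, ha, hb⟩
      · exact Relation.ReflTransGen.single ⟨hab, Or.inl ha, Or.inl hb⟩
      · exact Relation.ReflTransGen.head (huvR ha)
          (Relation.ReflTransGen.single ⟨hab, Or.inr ⟨rfl, ha⟩, Or.inl hb⟩)
      · exact Relation.ReflTransGen.head ⟨hab.symm, Or.inl ha, Or.inr ⟨rfl, hb⟩⟩
          (Relation.ReflTransGen.single (hRs _ _ (huvR hb)))
    have main : ∀ x ∈ φ i, ∀ y ∈ φ i, Relation.ReflTransGen R x y := by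
      intro x hx y hy
      have := h3 i x hx y hy
      clear hy
      induction this with
      | refl => exact Relation.ReflTransGen.refl
      | tail _ hbc ih => exact ih.trans (step _ _ hbc)
    rintro x (hx | ⟨rfl, hx⟩) y (hy | ⟨rfl, hy⟩)
    · exact main x hx y hy
    · exact (main x hx u hy).tail (huvR hy)
    · exact hsymm _ _ ((main y hy u hx).tail (huvR hx))
    · exact Relation.ReflTransGen.refl
  · intro i j hij
    rw [Set.disjoint_left]
    have hd := Set.disjoint_left.1 (h4 i j hij)
    rintro x (hx | ⟨rfl, hx⟩) (hy | ⟨hxy, hy⟩)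
    · exact hd hx hy
    · subst hxy; exact hvn i hx
    · exact hvn j hy
    · exact hd hx hy
  · intro i j hij
    obtain ⟨a, ha, b, hb, _, _, _, hab | ⟨rfl, hab⟩ | ⟨rfl, hab⟩⟩ := h5 i j hij
    · exact ⟨a, Or.inl ha, b, Or.inl hb, hab⟩
    · exact ⟨v, Or.inr ⟨rfl, ha⟩, b, Or.inl hb, hab⟩
    · exact ⟨a, Or.inl ha, v, Or.inr ⟨rfl, hb⟩, hab.symm⟩

open Classical in
lemma eCnt_contr {V : Type} {G : SimpleGraph V} {u v : V} {X : Finset V}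
    (huv : G.Adj u v) (hu : u ∈ X) (hv : v ∈ X) :
    eCnt G X ≤ eCnt (contr G u v) (X.erase v) + 2 +
      2 * (X.filter fun y => G.Adj u y ∧ G.Adj v y).card := by
  have huv' : u ≠ v := huv.ne
  set d := ∑ y ∈ X.erase v, if G.Adj v y then 1 else 0 with hd
  have e1 : eCnt G X = eCnt G (X.erase v) + 2 * d := by
    unfold eCnt
    rw [← Finset.sum_erase_add _ _ hv]
    have : ∀ x, (∑ y ∈ X, if G.Adj x y then 1 else 0)
        = (∑ y ∈ X.erase v, if G.Adj x y then 1 else 0) + if G.Adj x v then 1 else 0 := by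
      intro x
      rw [← Finset.sum_erase_add _ _ hv]
    simp only [this, Finset.sum_add_distrib]
    simp only [SimpleGraph.irrefl, if_false, add_zero]
    have : (∑ x ∈ X.erase v, if G.Adj x v then 1 else 0) = d := by
      rw [hd]; exact Finset.sum_congr rfl fun x _ => by simp [G.adj_comm]
    rw [this, ← hd]; ring
  -- new edges
  set q := ∑ y ∈ X.erase v, if y ≠ u ∧ G.Adj v y ∧ ¬ G.Adj u y then 1 else 0 with hq
  have hu' : u ∈ X.erase v := by simp [huv', hu]
  have e2 : eCnt G (X.erase v) + 2 * q ≤ eCnt (contr G u v) (X.erase v) := by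
    have a1 : q = ∑ x ∈ X.erase v, ∑ y ∈ X.erase v,
        if x = u then (if y ≠ u ∧ G.Adj v y ∧ ¬ G.Adj u y then 1 else 0) else 0 := by
      rw [Finset.sum_eq_single u]
      · simp [hq]
      · intro b _ hb; simp [hb]
      · intro h; exact absurd hu' h
    have a2 : q = ∑ x ∈ X.erase v, ∑ y ∈ X.erase v,
        if y = u then (if x ≠ u ∧ G.Adj v x ∧ ¬ G.Adj u x then 1 else 0) else 0 := by
      rw [Finset.sum_comm]; exact a1
    rw [two_mul]
    nth_rewrite 1 [a1]
    rw [a2]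
    unfold eCnt
    simp only [← Finset.sum_add_distrib]
    refine Finset.sum_le_sum fun x hx => Finset.sum_le_sum fun y hy => ?_
    have hxv : x ≠ v := (Finset.mem_erase.1 hx).1
    have hyv : y ≠ v := (Finset.mem_erase.1 hy).1
    simp only [contr]
    by_cases hxu : x = u
    · subst hxu
      by_cases hyx : y = x
      · subst hyx; simp
      · have := Ne.symm hyx
        by_cases g1 : G.Adj x y <;> by_cases g2 : G.Adj v y <;> simp [*]
    · by_cases hyu : y = u
      · subst hyu
        by_cases g1 : G.Adj y x
        · have g1' := g1.symm
          simp [*]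
        · have g1' : ¬ G.Adj x y := fun h => g1 h.symm
          by_cases g2 : G.Adj v x <;> simp [*]
      · by_cases g1 : G.Adj x y
        · have := g1.ne
          simp [*]
        · simp [*]
  have e3 : d ≤ q + 1 + (X.filter fun y => G.Adj u y ∧ G.Adj v y).card := by
    have b1 : (1 : ℕ) = ∑ y ∈ X.erase v, if y = u then 1 else 0 := by
      rw [Finset.sum_ite_eq']; simp [hu']
    have b2 : (∑ y ∈ X.erase v, if G.Adj u y ∧ G.Adj v y then 1 else 0) ≤
        (X.filter fun y => G.Adj u y ∧ G.Adj v y).card := by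
      rw [Finset.card_filter]
      exact Finset.sum_le_sum_of_subset (Finset.erase_subset _ _)
    refine le_trans ?_ (Nat.add_le_add_left b2 _)
    nth_rewrite 1 [b1]
    rw [hq, hd]
    simp only [← Finset.sum_add_distrib]
    refine Finset.sum_le_sum fun y hy => ?_
    by_cases hyu : y = u <;> by_cases g1 : G.Adj u y <;> by_cases g2 : G.Adj v y <;>
      simp only [hyu, g1, g2, if_true, if_false, true_and, and_true, false_and, and_false,
        ne_eq, not_true, not_false_eq_true] <;> first | omega | (split_ifs <;> omega)
  omega

open Classical in
lemma exists_adj_of_eCnt {V : Type} {G : SimpleGraph V} {X : Finset V} (h : 0 < eCnt G X) :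
    ∃ u ∈ X, ∃ v ∈ X, G.Adj u v := by
  by_contra hc
  push Not at hc
  have : eCnt G X = 0 := by
    unfold eCnt
    refine Finset.sum_eq_zero fun x hx => Finset.sum_eq_zero fun y hy => ?_
    simp [hc x hx y hy]
  omega

open Classical in
lemma dense_minor {V : Type} (r : ℕ) : ∀ (m : ℕ) (G : SimpleGraph V) (X : Finset V),
    X.card = m → X.Nonempty → 2 * 2 ^ r * X.card ≤ eCnt G X → KMinorIn (r + 2) G X := by
  induction r with
  | zero =>
    intro m G X _ hne he
    have := hne.card_pos
    obtain ⟨u, hu, v, hv, huv⟩ := exists_adj_of_eCnt (G := G) (X := X) (by omega)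
    refine ⟨![{u}, {v}], ?_, ?_, ?_, ?_, ?_⟩
    · intro i; fin_cases i <;> simp
    · intro i; fin_cases i <;> simp [hu, hv]
    · intro i; fin_cases i <;> simp [connIn_singleton]
    · intro i j hij; fin_cases i <;> fin_cases j <;> simp_all [huv.ne, huv.ne']
    · intro i j hij; fin_cases i <;> fin_cases j <;> simp_all [huv.symm]
  | succ r ihr =>
    intro m
    induction m with
    | zero =>
      intro G X h0 hne
      simp_all
    | succ m ihm =>
      intro G X hm hne he
      have hpos := hne.card_pos
      have h2 : 0 < 2 ^ (r + 1) := by positivity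
      by_cases hc : ∃ u ∈ X, ∃ v ∈ X, G.Adj u v ∧
          (X.filter fun y => G.Adj u y ∧ G.Adj v y).card < 2 ^ (r + 1)
      · obtain ⟨u, hu, v, hv, huv, hlt⟩ := hc
        have hcard : (X.erase v).card = m := by rw [Finset.card_erase_of_mem hv, hm]; rfl
        have h1 := eCnt_contr huv hu hv
        refine KMinorIn.lift huv hv (ihm _ _ hcard ⟨u, by simp [huv.ne, hu]⟩ ?_)
        rw [hm] at he
        rw [hcard]
        have : 2 * 2 ^ (r + 1) * (m + 1) = 2 * 2 ^ (r + 1) * m + 2 * 2 ^ (r + 1) := by ring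
        omega
      · push Not at hc
        obtain ⟨v, hv, w, hw, hvw⟩ := exists_adj_of_eCnt (G := G) (X := X)
          (lt_of_lt_of_le (by positivity) he)
        set Y := X.filter fun y => G.Adj v y with hY
        have hYe : 2 * 2 ^ r * Y.card ≤ eCnt G Y := by
          have : 2 * 2 ^ r * Y.card = ∑ y ∈ Y, 2 ^ (r + 1) := by
            simp; ring
          rw [this]
          refine Finset.sum_le_sum fun y hy => ?_
          have hy' := Finset.mem_filter.1 hy
          refine (hc v hv y hy'.1 hy'.2).trans ?_
          rw [← Finset.card_filter, hY, Finset.filter_filter]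
        obtain ⟨φ, k1, k2, k3, k4, k5⟩ := ihr Y.card G Y rfl
          ⟨w, by simp [hY, hw, hvw]⟩ hYe
        have hadj : ∀ i, ∀ x ∈ φ i, x ∈ X ∧ G.Adj v x := fun i x hx => by
          have := k2 i hx
          simpa [hY] using this
        refine ⟨Fin.cons {v} φ, ?_, ?_, ?_, ?_, ?_⟩
        · intro i; refine Fin.cases ?_ (fun i => ?_) i
          · simp
          · simpa using k1 i
        · intro i; refine Fin.cases ?_ (fun i => ?_) i
          · simpa using hv
          · simp only [Fin.cons_succ]
            intro x hx; exact (hadj i x hx).1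
        · intro i; refine Fin.cases ?_ (fun i => ?_) i
          · simpa using connIn_singleton G v
          · simpa using k3 i
        · intro i j; refine Fin.cases ?_ (fun i => ?_) i <;>
            refine Fin.cases ?_ (fun j => ?_) j
          · simp
          · intro _
            simp only [Fin.cons_zero, Fin.cons_succ, Set.disjoint_singleton_left]
            intro h; exact (hadj j v h).2.ne rfl
          · intro _
            simp only [Fin.cons_zero, Fin.cons_succ, Set.disjoint_singleton_right]
            intro h; exact (hadj i v h).2.ne rfl
          · intro h
            simp only [Fin.cons_succ]
            exact k4 i j (fun hh => h (by rw [hh]))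
        · intro i j; refine Fin.cases ?_ (fun i => ?_) i <;>
            refine Fin.cases ?_ (fun j => ?_) j
          · simp
          · intro _
            obtain ⟨x, hx⟩ := k1 j
            exact ⟨v, by simp, x, by simpa using hx, (hadj j x hx).2⟩
          · intro _
            obtain ⟨x, hx⟩ := k1 i
            exact ⟨x, by simpa using hx, v, by simp, (hadj i x hx).2.symm⟩
          · intro h
            simp only [Fin.cons_succ]
            exact k5 i j (fun hh => h (by rw [hh]))

lemma planar_eCnt {V : Type} {G : SimpleGraph V} (h : G.IsPlanar) (X : Finset V) :
    eCnt G X ≤ 16 * X.card := by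
  by_contra hc
  push Not at hc
  have hne : X.Nonempty := by
    by_contra h0
    rw [Finset.not_nonempty_iff_eq_empty] at h0
    subst h0
    simp [eCnt] at hc
  obtain ⟨φ, k1, k2, k3, k4, k5⟩ := dense_minor 3 X.card G X rfl hne (by norm_num; omega)
  refine h.1 ⟨φ, k1, fun i => (k3 i).connected (k1 i), fun i j hij => k4 i j hij, ?_⟩
  intro i j hij
  exact k5 i j (by simpa [SimpleGraph.completeGraph] using hij)

open Classical in
lemma planar_common {n : ℕ} {G : SimpleGraph (Fin n)} (h : G.IsPlanar) {u v w : Fin n}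
    (huv : u ≠ v) (huw : u ≠ w) (hvw : v ≠ w) :
    (Finset.univ.filter fun c => G.Adj u c ∧ G.Adj v c ∧ G.Adj w c).card ≤ 2 := by
  by_contra hc
  push Not at hc
  obtain ⟨a, b, c, ha, hb, hc, hab, hac, hbc⟩ := Finset.two_lt_card_iff.1 hc
  simp only [Finset.mem_filter, Finset.mem_univ, true_and] at ha hb hc
  have hL : Function.Injective ![u, v, w] := by
    intro i j; fin_cases i <;> fin_cases j <;> simp [huv, huw, hvw, huv.symm, huw.symm, hvw.symm]
  have hR : Function.Injective ![a, b, c] := by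
    intro i j; fin_cases i <;> fin_cases j <;> simp [hab, hac, hbc, hab.symm, hac.symm, hbc.symm]
  have hA : ∀ i j, G.Adj (![u, v, w] i) (![a, b, c] j) := by
    intro i j; fin_cases i <;> fin_cases j <;> simp [*]
  let f : Fin 3 ⊕ Fin 3 → Fin n := Sum.elim ![u, v, w] ![a, b, c]
  have hf : Function.Injective f := by
    rintro (i | i) (j | j) hij
    · exact congrArg _ (hL hij)
    · exact absurd hij (hA i j).ne
    · exact absurd hij (hA j i).ne'
    · exact congrArg _ (hR hij)
  refine h.2 ⟨fun i => {f i}, fun i => by simp, ?_, ?_, ?_⟩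
  · intro i
    exact (connIn_singleton G (f i)).connected (by simp)
  · intro i j hij
    simpa using fun h => hij (hf h)
  · rintro (i | i) (j | j) hij
    · simp at hij
    · exact ⟨_, rfl, _, rfl, hA i j⟩
    · exact ⟨_, rfl, _, rfl, (hA j i).symm⟩
    · simp at hij

lemma hub_planar (n : ℕ) (G : SimpleGraph (Fin n))
    (hG : ∀ x y, G.Adj x y → x.val < 2 ∨ y.val < 2) : G.IsPlanar := by
  -- any three pairwise-disjoint sets contain one avoiding the hubs
  have key : ∀ {W : Type} (H : SimpleGraph W) (φ : W → Set (Fin n)),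
      (Pairwise fun w₁ w₂ => Disjoint (φ w₁) (φ w₂)) →
      (∀ ⦃w₁ w₂⦄, H.Adj w₁ w₂ → ∃ a ∈ φ w₁, ∃ b ∈ φ w₂, G.Adj a b) →
      ∃ p q : W → Prop, (∀ w w', p w → p w' → w = w') ∧ (∀ w w', q w → q w' → w = w') ∧
        ∀ w₁ w₂, H.Adj w₁ w₂ → p w₁ ∨ q w₁ ∨ p w₂ ∨ q w₂ := by
    intro W H φ hd ha
    have uniq : ∀ (k : ℕ) (w w' : W), (∃ x ∈ φ w, x.val = k) → (∃ x ∈ φ w', x.val = k) →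
        w = w' := by
      rintro k w w' ⟨x, hx, hxk⟩ ⟨y, hy, hyk⟩
      by_contra hne
      have : x = y := Fin.ext (hxk.trans hyk.symm)
      subst this
      exact Set.disjoint_left.1 (hd hne) hx hy
    refine ⟨fun w => ∃ x ∈ φ w, x.val = 0, fun w => ∃ x ∈ φ w, x.val = 1, uniq 0, uniq 1, ?_⟩
    intro w₁ w₂ h
    obtain ⟨a, ha1, b, hb1, hab⟩ := ha h
    rcases hG a b hab with h | h
    · rcases (by omega : a.val = 0 ∨ a.val = 1) with h | h
      · exact Or.inl ⟨a, ha1, h⟩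
      · exact Or.inr (Or.inl ⟨a, ha1, h⟩)
    · rcases (by omega : b.val = 0 ∨ b.val = 1) with h | h
      · exact Or.inr (Or.inr (Or.inl ⟨b, hb1, h⟩))
      · exact Or.inr (Or.inr (Or.inr ⟨b, hb1, h⟩))
  -- among three elements one avoids both
  have three : ∀ {W : Type} (p q : W → Prop), (∀ w w', p w → p w' → w = w') →
      (∀ w w', q w → q w' → w = w') → ∀ a b c : W, a ≠ b → a ≠ c → b ≠ c →
      ∃ x, (x = a ∨ x = b ∨ x = c) ∧ ¬ p x ∧ ¬ q x := by
    intro W p q hp hq a b c hab hac hbc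
    by_contra hcon
    push Not at hcon
    have ha := hcon a (by simp)
    have hb := hcon b (by simp)
    have hc := hcon c (by simp)
    have p1 := hp a b; have p2 := hp a c; have p3 := hp b c
    have q1 := hq a b; have q2 := hq a c; have q3 := hq b c
    clear hcon hp hq
    by_cases pa : p a
    · by_cases pb : p b
      · exact hab (p1 pa pb)
      · by_cases pc : p c
        · exact hac (p2 pa pc)
        · exact hbc (q3 (hb pb) (hc pc))
    · by_cases pb : p b
      · by_cases pc : p c
        · exact hbc (p3 pb pc)
        · exact hac (q2 (ha pa) (hc pc))
      · exact hab (q1 (ha pa) (hb pb))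
  constructor
  · rintro ⟨φ, -, -, hd, ha⟩
    obtain ⟨p, q, hp, hq, h⟩ := key _ φ hd ha
    obtain ⟨x, hx, hpx, hqx⟩ := three p q hp hq 0 1 2 (by decide) (by decide) (by decide)
    have : ∃ a b c : Fin 5, a ≠ b ∧ a ≠ c ∧ b ≠ c ∧ a ≠ x ∧ b ≠ x ∧ c ≠ x := by
      clear hx hpx hqx; revert x; decide
    obtain ⟨a, b, c, hab, hac, hbc, hax, hbx, hcx⟩ := this
    obtain ⟨y, hy, hpy, hqy⟩ := three p q hp hq a b c hab hac hbc
    have hxy : x ≠ y := by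
      rcases hy with rfl | rfl | rfl
      · exact hax.symm
      · exact hbx.symm
      · exact hcx.symm
    have := h x y (by simpa [SimpleGraph.completeGraph] using hxy)
    simp_all only [or_self]
  · rintro ⟨φ, -, -, hd, ha⟩
    obtain ⟨p, q, hp, hq, h⟩ := key _ φ hd ha
    obtain ⟨x, hx, hpx, hqx⟩ := three p q hp hq (Sum.inl 0) (Sum.inl 1) (Sum.inl 2)
      (by decide) (by decide) (by decide)
    obtain ⟨y, hy, hpy, hqy⟩ := three p q hp hq (Sum.inr 0) (Sum.inr 1) (Sum.inr 2)
      (by decide) (by decide) (by decide)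
    have hxy : (completeBipartiteGraph (Fin 3) (Fin 3)).Adj x y := by
      rcases hx with rfl | rfl | rfl <;> rcases hy with rfl | rfl | rfl <;> simp
    have := h x y hxy
    simp_all only [or_self]

/-- tuples giving paths -/
def IsP5 {n : ℕ} (G : SimpleGraph (Fin n)) (t : Fin n × Fin n × Fin n × Fin n × Fin n) : Prop :=
  G.Adj t.1 t.2.1 ∧ G.Adj t.2.1 t.2.2.1 ∧ G.Adj t.2.2.1 t.2.2.2.1 ∧
    G.Adj t.2.2.2.1 t.2.2.2.2 ∧ [t.1, t.2.1, t.2.2.1, t.2.2.2.1, t.2.2.2.2].Nodup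

noncomputable def p5equiv {n : ℕ} (G : SimpleGraph (Fin n)) :
    {t : Fin n × Fin n × Fin n × Fin n × Fin n // IsP5 G t} ≃
    {p : Σ u v : Fin n, G.Walk u v // p.2.2.IsPath ∧ p.2.2.length = 4} := by
  refine Equiv.ofBijective (fun t => ⟨⟨t.1.1, t.1.2.2.2.2,
    .cons t.2.1 (.cons t.2.2.1 (.cons t.2.2.2.1 (.cons t.2.2.2.2.1 .nil)))⟩, ?_, ?_⟩) ⟨?_, ?_⟩
  · rw [SimpleGraph.Walk.isPath_def]
    simpa using t.2.2.2.2.2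
  · simp
  · rintro ⟨⟨a, b, c, d, e⟩, h⟩ ⟨⟨a', b', c', d', e'⟩, h'⟩ heq
    have := congrArg (fun p => p.1.2.2.support) heq
    simpa using this
  · rintro ⟨⟨u, v, p⟩, hp, hl⟩
    dsimp only at hp hl
    match p, hp, hl with
    | .cons (v := b) h1 (.cons (v := c) h2 (.cons (v := d) h3 (.cons h4 .nil))), hp, _ =>
      refine ⟨⟨⟨u, b, c, d, v⟩, h1, h2, h3, h4, ?_⟩, rfl⟩
      rw [SimpleGraph.Walk.isPath_def] at hp
      simpa using hp

lemma numP4_eq {n : ℕ} (G : SimpleGraph (Fin n)) :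
    numP4 n G = (Nat.card {t : Fin n × Fin n × Fin n × Fin n × Fin n // IsP5 G t} : ℝ) / 2 := by
  unfold numP4
  rw [Nat.card_congr (p5equiv G)]

def hubG (n : ℕ) : SimpleGraph (Fin n) where
  Adj x y := (x.val < 2 ∧ 2 ≤ y.val) ∨ (2 ≤ x.val ∧ y.val < 2)
  symm := ⟨by rintro x y (h | h); exacts [Or.inr ⟨h.2, h.1⟩, Or.inl ⟨h.2, h.1⟩]⟩
  loopless := ⟨by rintro x (h | h) <;> omega⟩

lemma lower (n : ℕ) : ∃ G : SimpleGraph (Fin n), G.IsPlanar ∧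
    (n : ℝ) ^ 3 - 10 * (n : ℝ) ^ 2 ≤ numP4 n G := by
  refine ⟨hubG n, hub_planar n _ ?_, ?_⟩
  · rintro x y (h | h)
    · exact Or.inl h.1
    · exact Or.inr h.2
  rcases Nat.lt_or_ge n 10 with hn | hn
  · have h0 : 0 ≤ numP4 n (hubG n) := by unfold numP4; positivity
    have : (n : ℝ) ≤ 10 := by exact_mod_cast hn.le
    nlinarith [sq_nonneg (n : ℝ)]
  obtain ⟨m, rfl⟩ : ∃ m, n = m + 2 := ⟨n - 2, by omega⟩
  rw [numP4_eq]
  let z : Fin 2 → Fin (m + 2) := fun i => ⟨i.val, by omega⟩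
  let g : Fin 2 × (Fin 3 ↪ Fin m) →
      {t : Fin (m+2) × Fin (m+2) × Fin (m+2) × Fin (m+2) × Fin (m+2) // IsP5 (hubG (m+2)) t} :=
    fun q => ⟨((q.2 0).natAdd 2 |>.cast (by omega), ⟨q.1.val, by omega⟩,
      (q.2 1).natAdd 2 |>.cast (by omega), ⟨1 - q.1.val, by omega⟩,
      (q.2 2).natAdd 2 |>.cast (by omega)), by
        have h01 : (q.2 0).val ≠ (q.2 1).val := fun h => absurd (q.2.injective (Fin.ext h)) (by decide)
        have h02 : (q.2 0).val ≠ (q.2 2).val := fun h => absurd (q.2.injective (Fin.ext h)) (by decide)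
        have h12 : (q.2 1).val ≠ (q.2 2).val := fun h => absurd (q.2.injective (Fin.ext h)) (by decide)
        have := q.1.isLt
        simp only [IsP5, hubG, Fin.val_cast, Fin.val_natAdd, List.nodup_cons, List.mem_cons,
          List.not_mem_nil, Fin.ext_iff]
        simp only [or_false, not_false_eq_true, List.nodup_nil, and_true]
        omega⟩
  have hg : Function.Injective g := by
    rintro ⟨i, f⟩ ⟨j, f'⟩ h
    simp only [g, Subtype.mk.injEq, Prod.mk.injEq, Fin.ext_iff, Fin.val_cast, Fin.val_natAdd] at h
    obtain ⟨h1, h2, h3, h4, h5⟩ := h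
    simp only [Prod.mk.injEq]
    refine ⟨Fin.ext h2, ?_⟩
    ext k
    fin_cases k
    · simpa using h1
    · simpa using h3
    · simpa using h5
  have hc := Nat.card_le_card_of_injective g hg
  rw [Nat.card_prod, Nat.card_eq_fintype_card (α := Fin 3 ↪ Fin m), Fintype.card_embedding_eq] at hc
  simp only [Nat.card_eq_fintype_card (α := Fin 2), Fintype.card_fin] at hc
  obtain ⟨k, rfl⟩ : ∃ k, m = k + 2 := ⟨m - 2, by omega⟩
  have hdf : (k + 2).descFactorial 3 = (k + 2) * (k + 1) * k := by
    simp [Nat.descFactorial]; ring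
  rw [hdf] at hc
  have hc' : (2 * ((k + 2) * (k + 1) * k) : ℝ) ≤
      (Nat.card {t : Fin (k+2+2) × Fin (k+2+2) × Fin (k+2+2) × Fin (k+2+2) × Fin (k+2+2) //
        IsP5 (hubG (k+2+2)) t} : ℝ) := by exact_mod_cast hc
  rw [le_div_iff₀ (by norm_num)]
  refine le_trans ?_ hc'
  push_cast
  have : (0:ℝ) ≤ k := by positivity
  nlinarith [sq_nonneg (k:ℝ)]

structure PCtx {n : ℕ} (A : Fin n → Fin n → ℝ) : Prop where
  h01 : ∀ u v, A u v = 0 ∨ A u v = 1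
  hsym : ∀ u v, A u v = A v u
  hirr : ∀ u, A u u = 0
  h1 : ∀ X : Finset (Fin n), ∑ x ∈ X, ∑ y ∈ X, A x y ≤ 16 * (X.card : ℝ)
  h2 : ∀ u v w, u ≠ v → u ≠ w → v ≠ w → ∑ c, A u c * A v c * A w c ≤ 2

def Dg {n : ℕ} (A : Fin n → Fin n → ℝ) (u : Fin n) : ℝ := ∑ v, A u v
def cod {n : ℕ} (A : Fin n → Fin n → ℝ) (b d : Fin n) : ℝ := ∑ c, A b c * A d c

namespace PCtx
variable {n : ℕ} {A : Fin n → Fin n → ℝ}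

lemma nonneg (h : PCtx A) (u v : Fin n) : 0 ≤ A u v := by
  rcases h.h01 u v with h | h <;> rw [h] <;> norm_num

lemma le_one (h : PCtx A) (u v : Fin n) : A u v ≤ 1 := by
  rcases h.h01 u v with h | h <;> rw [h]; norm_num

lemma D_nonneg (h : PCtx A) (u : Fin n) : 0 ≤ Dg A u :=
  Finset.sum_nonneg fun v _ => h.nonneg u v

lemma D_le (h : PCtx A) (u : Fin n) : Dg A u ≤ n := by
  calc Dg A u ≤ ∑ _v : Fin n, (1 : ℝ) := Finset.sum_le_sum fun v _ => h.le_one u v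
    _ = n := by simp

lemma sumD (h : PCtx A) : ∑ u, Dg A u ≤ 16 * (n : ℝ) := by
  simpa [Dg] using h.h1 Finset.univ

lemma cod_nonneg (h : PCtx A) (b d : Fin n) : 0 ≤ cod A b d :=
  Finset.sum_nonneg fun c _ => mul_nonneg (h.nonneg _ _) (h.nonneg _ _)

lemma cod_comm (b d : Fin n) : cod A b d = cod A d b :=
  Finset.sum_congr rfl fun c _ => mul_comm _ _

lemma cod_le (h : PCtx A) (b d : Fin n) : cod A b d ≤ Dg A b :=
  Finset.sum_le_sum fun c _ => by nlinarith [h.nonneg b c, h.le_one d c]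

lemma DD_le (h : PCtx A) (b d : Fin n) : Dg A b + Dg A d ≤ n + cod A b d := by
  have : (n : ℝ) = ∑ _c : Fin n, (1 : ℝ) := by simp
  rw [this]
  unfold Dg cod
  rw [← Finset.sum_add_distrib, ← Finset.sum_add_distrib]
  exact Finset.sum_le_sum fun c _ => by nlinarith [h.le_one b c, h.le_one d c]

lemma sum_cod (h : PCtx A) (b : Fin n) : ∑ d, cod A b d = ∑ c, A b c * Dg A c := by
  unfold cod Dg
  rw [Finset.sum_comm]
  refine Finset.sum_congr rfl fun c _ => ?_
  rw [Finset.mul_sum]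
  exact Finset.sum_congr rfl fun d _ => by rw [h.hsym d c]

lemma sum_cod_le (h : PCtx A) (b : Fin n) : ∑ d, cod A b d ≤ 16 * (n : ℝ) := by
  rw [h.sum_cod]
  refine le_trans (Finset.sum_le_sum fun c _ => ?_) h.sumD
  nlinarith [h.D_nonneg c, h.le_one b c]

lemma D_nat (h : PCtx A) (u : Fin n) : ∃ k : ℕ, Dg A u = k := by
  refine ⟨(Finset.univ.filter fun v => A u v = 1).card, ?_⟩
  rw [Finset.card_filter]
  push_cast
  refine Finset.sum_congr rfl fun v _ => ?_
  rcases h.h01 u v with h | h <;> simp [h]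

lemma walk3 (h : PCtx A) : ∑ u, ∑ v, A u v * (Dg A u * Dg A v) ≤ 256 * (n : ℝ) ^ 2 := by
  choose g hg using h.D_nat
  have hgn : ∀ u, g u ≤ n := fun u => by
    have := h.D_le u
    rw [hg] at this
    exact_mod_cast this
  have hmin : ∀ u v, Dg A u * Dg A v ≤
      n * ∑ k ∈ Finset.range n, (if k < g u then if k < g v then (1 : ℝ) else 0 else 0) := by
    intro u v
    have e : ∑ k ∈ Finset.range n, (if k < g u then if k < g v then (1 : ℝ) else 0 else 0)
        = (min (g u) (g v) : ℕ) := by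
      simp_rw [← ite_and]
      rw [← Finset.sum_filter]
      simp only [Finset.sum_const, nsmul_eq_mul, mul_one]
      congr 1
      have : (Finset.range n).filter (fun k => k < g u ∧ k < g v)
          = Finset.range (min (g u) (g v)) := by
        ext k
        simp only [Finset.mem_filter, Finset.mem_range, lt_min_iff]
        have := hgn u
        constructor
        · exact fun h => h.2
        · exact fun h => ⟨by omega, h⟩
      rw [this, Finset.card_range]
    rw [e, hg, hg, ← Nat.cast_mul, ← Nat.cast_mul, ← max_mul_min]
    exact_mod_cast Nat.mul_le_mul_right _ (max_le (hgn u) (hgn v))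
  have hlayer : ∀ u, ∑ k ∈ Finset.range n, (if k < g u then (1 : ℝ) else 0) = g u := by
    intro u
    rw [← Finset.sum_filter]
    simp only [Finset.sum_const, nsmul_eq_mul, mul_one]
    congr 1
    have : (Finset.range n).filter (fun k => k < g u) = Finset.range (g u) := by
      ext k
      simp only [Finset.mem_filter, Finset.mem_range]
      have := hgn u
      omega
    rw [this, Finset.card_range]
  calc ∑ u, ∑ v, A u v * (Dg A u * Dg A v)
      ≤ ∑ u, ∑ v, A u v * (n * ∑ k ∈ Finset.range n,
          (if k < g u then if k < g v then (1 : ℝ) else 0 else 0)) :=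
        Finset.sum_le_sum fun u _ => Finset.sum_le_sum fun v _ =>
          mul_le_mul_of_nonneg_left (hmin u v) (h.nonneg u v)
    _ = n * ∑ u, ∑ v, ∑ k ∈ Finset.range n,
          (if k < g u then if k < g v then A u v else 0 else 0) := by
        simp only [Finset.mul_sum]
        refine Finset.sum_congr rfl fun u _ => Finset.sum_congr rfl fun v _ =>
          Finset.sum_congr rfl fun k _ => ?_
        split_ifs <;> ring
    _ = n * ∑ k ∈ Finset.range n, ∑ u ∈ Finset.univ.filter (fun u => k < g u),
          ∑ v ∈ Finset.univ.filter (fun u => k < g u), A u v := by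
        congr 1
        have : ∀ u, ∑ v, ∑ k ∈ Finset.range n,
            (if k < g u then if k < g v then A u v else 0 else 0)
            = ∑ k ∈ Finset.range n, ∑ v,
            (if k < g u then if k < g v then A u v else 0 else 0) := fun u => Finset.sum_comm
        simp only [this]
        rw [Finset.sum_comm]
        refine Finset.sum_congr rfl fun k _ => ?_
        rw [Finset.sum_filter]
        refine Finset.sum_congr rfl fun u _ => ?_
        rw [Finset.sum_filter]
        split_ifs <;> simp
    _ ≤ n * ∑ k ∈ Finset.range n, 16 * ((Finset.univ.filter (fun u => k < g u)).card : ℝ) := by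
        refine mul_le_mul_of_nonneg_left (Finset.sum_le_sum fun k _ => h.h1 _) (by positivity)
    _ = n * (16 * ∑ u, Dg A u) := by
        congr 1
        rw [← Finset.mul_sum]
        congr 1
        simp only [Finset.card_filter]
        push_cast
        rw [Finset.sum_comm]
        exact Finset.sum_congr rfl fun u _ => by rw [hlayer, hg]
    _ ≤ n * (16 * (16 * n)) := by
        have := h.sumD
        gcongr
    _ = 256 * (n : ℝ) ^ 2 := by ring

/-- weighted pair sum -/
noncomputable def W {n : ℕ} (A : Fin n → Fin n → ℝ) : ℝ :=
  ∑ b, ∑ d, if b = d then 0 else cod A b d * (Dg A b * Dg A d)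

lemma caseA (h : PCtx A) (u v : Fin n) (huv : u ≠ v)
    (ht : 360 * ((n : ℝ) - cod A u v) ≤ n) : W A ≤ 2 * (n : ℝ) ^ 3 + 640 * (n : ℝ) ^ 2 := by
  set t : ℝ := (n : ℝ) - cod A u v with ht_def
  have hn0 : (0 : ℝ) ≤ n := Nat.cast_nonneg n
  have ht0 : 0 ≤ t := by
    have := (h.cod_le u v).trans (h.D_le u)
    linarith
  let T : Finset (Fin n) := Finset.univ.filter fun x => x ≠ u ∧ x ≠ v ∧ A u x * A v x = 0
  let m : Fin n → ℝ := fun w => ∑ x ∈ T, A w x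
  have hm0 : ∀ w, 0 ≤ m w := fun w => Finset.sum_nonneg fun x _ => h.nonneg w x
  have hTcard : (T.card : ℝ) ≤ t := by
    have : (T.card : ℝ) = ∑ x : Fin n, if x ≠ u ∧ x ≠ v ∧ A u x * A v x = 0 then (1:ℝ) else 0 := by
      simp only [T, Finset.card_filter]; push_cast; rfl
    have hn : (n : ℝ) = ∑ _c : Fin n, (1 : ℝ) := by simp
    have : (T.card : ℝ) + cod A u v ≤ n := by
      rw [this, hn]
      unfold cod
      rw [← Finset.sum_add_distrib]
      refine Finset.sum_le_sum fun x _ => ?_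
      rcases h.h01 u x with h1 | h1 <;> rcases h.h01 v x with h2 | h2 <;>
        simp only [h1, h2] <;> split_ifs with hh <;> first | (norm_num; done) | (exfalso; simp at hh; done)
    linarith
  have hmt : ∀ w, m w ≤ t := fun w => by
    refine le_trans ?_ hTcard
    calc m w ≤ ∑ _x ∈ T, (1 : ℝ) := Finset.sum_le_sum fun x _ => h.le_one w x
      _ = T.card := by simp
  -- neighbours outside the hubs
  have hsplit : ∀ w, w ≠ u → w ≠ v →
      (∑ x, if x ≠ u ∧ x ≠ v then A w x else 0) ≤ 2 + m w := by
    intro w hwu hwv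
    have h3 := h.h2 u v w huv hwu.symm hwv.symm
    have : m w = ∑ x, if x ≠ u ∧ x ≠ v ∧ A u x * A v x = 0 then A w x else 0 := by
      simp only [m, T, Finset.sum_filter]
    refine le_trans ?_ (add_le_add_left h3 _)
    rw [this, ← Finset.sum_add_distrib]
    refine Finset.sum_le_sum fun x _ => ?_
    have hw := h.nonneg w x
    rcases h.h01 u x with h1 | h1 <;> rcases h.h01 v x with h2 | h2 <;>
        simp only [h1, h2] <;> split_ifs <;> simp_all
  have hD : ∀ w, w ≠ u → w ≠ v → Dg A w ≤ 4 + m w := by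
    intro w hwu hwv
    have h3 := hsplit w hwu hwv
    have : Dg A w ≤ (∑ x, if x ≠ u ∧ x ≠ v then A w x else 0) + A w u + A w v := by
      have e1 : A w u = ∑ x, if x = u then A w x else 0 := by simp
      have e2 : A w v = ∑ x, if x = v then A w x else 0 := by simp
      rw [e1, e2, ← Finset.sum_add_distrib, ← Finset.sum_add_distrib]
      unfold Dg
      refine Finset.sum_le_sum fun x _ => ?_
      by_cases hxu : x = u
      · subst hxu; simp [huv]
      · by_cases hxv : x = v
        · subst hxv; simp [hxu]
        · simp [hxu, hxv]
    have := h.le_one w u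
    have := h.le_one w v
    linarith
  let q : Fin n → ℝ := fun w => if w ≠ u ∧ w ≠ v then Dg A w else 0
  have hq0 : ∀ w, 0 ≤ q w := fun w => by
    simp only [q]; split_ifs
    · exact h.D_nonneg w
    · exact le_rfl
  let m' : Fin n → ℝ := fun w => if w ≠ u ∧ w ≠ v then m w else 0
  have hsm : ∑ w, m' w ≤ 18 * t := by
    have e : ∑ w, m' w = ∑ x ∈ T, ∑ w, if w ≠ u ∧ w ≠ v then A x w else 0 := by
      rw [Finset.sum_comm]
      refine Finset.sum_congr rfl fun w _ => ?_
      simp only [m', m]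
      split_ifs
      · exact Finset.sum_congr rfl fun x _ => h.hsym w x
      · simp
    rw [e]
    calc ∑ x ∈ T, ∑ w, (if w ≠ u ∧ w ≠ v then A x w else 0)
        ≤ ∑ x ∈ T, (2 + m x) := Finset.sum_le_sum fun x hx => by
          have hx' := (Finset.mem_filter.1 hx).2
          exact hsplit x hx'.1 hx'.2.1
      _ = 2 * T.card + ∑ x ∈ T, ∑ y ∈ T, A x y := by
          rw [Finset.sum_add_distrib]; simp [m]; ring
      _ ≤ 2 * T.card + 16 * T.card := by have := h.h1 T; linarith
      _ ≤ 18 * t := by linarith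
  have hq2 : ∑ w, q w ^ 2 ≤ 32 * n + 36 * t ^ 2 := by
    calc ∑ w, q w ^ 2 ≤ ∑ w, (32 + 2 * t * m' w) := by
          refine Finset.sum_le_sum fun w _ => ?_
          simp only [q, m']
          split_ifs with hw
          · have h1 := hD w hw.1 hw.2
            have h2 := h.D_nonneg w
            have h3 := hm0 w
            have h4 := hmt w
            have : Dg A w ^ 2 ≤ (4 + m w) ^ 2 := by gcongr
            nlinarith [sq_nonneg (m w - 4), mul_nonneg h3 (sub_nonneg.2 h4)]
          · norm_num
      _ = 32 * n + 2 * t * ∑ w, m' w := by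
          rw [Finset.sum_add_distrib, Finset.mul_sum]; simp; ring
      _ ≤ 32 * n + 2 * t * (18 * t) := by gcongr
      _ = _ := by ring
  -- pointwise bound
  have hpt : ∀ b d, (if b = d then 0 else cod A b d * (Dg A b * Dg A d)) ≤
      (if b = u then if d = v then cod A u v * n ^ 2 else 0 else 0) +
      (if b = v then if d = u then cod A u v * n ^ 2 else 0 else 0) +
      (if b = u then n * q d ^ 2 else 0) + (if b = v then n * q d ^ 2 else 0) +
      (if d = u then n * q b ^ 2 else 0) + (if d = v then n * q b ^ 2 else 0) +
      cod A b d * (q b ^ 2 / 2) + cod A b d * (q d ^ 2 / 2) := by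
    intro b d
    have hc := h.cod_nonneg b d
    have hDb := h.D_nonneg b
    have hDd := h.D_nonneg d
    have hDbn := h.D_le b
    have hDdn := h.D_le d
    have s1 : 0 ≤ cod A b d * (q b ^ 2 / 2) := by positivity
    have s2 : 0 ≤ cod A b d * (q d ^ 2 / 2) := by positivity
    have s3 : 0 ≤ n * q b ^ 2 := by positivity
    have s4 : 0 ≤ n * q d ^ 2 := by positivity
    have s5 : 0 ≤ cod A u v * n ^ 2 := mul_nonneg (h.cod_nonneg _ _) (by positivity)
    have s6 : Dg A b * Dg A d ≤ n ^ 2 := by rw [sq]; gcongr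
    have s7 : cod A b d * (Dg A b * Dg A d) ≤ n * Dg A b ^ 2 := by
      have := h.cod_le b d
      calc cod A b d * (Dg A b * Dg A d) ≤ Dg A b * (Dg A b * n) := by gcongr
        _ = _ := by ring
    have s8 : cod A b d * (Dg A b * Dg A d) ≤ n * Dg A d ^ 2 := by
      have := h.cod_le d b
      rw [cod_comm] at this
      calc cod A b d * (Dg A b * Dg A d) ≤ Dg A d * (n * Dg A d) := by gcongr
        _ = _ := by ring
    have s9 : cod A b d * (Dg A b * Dg A d) ≤
        cod A b d * (Dg A b ^ 2 / 2) + cod A b d * (Dg A d ^ 2 / 2) := by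
      rw [← mul_add]
      exact mul_le_mul_of_nonneg_left (by nlinarith [sq_nonneg (Dg A b - Dg A d)]) hc
    by_cases hbd : b = d
    · rw [if_pos hbd]
      split_ifs <;> linarith
    rw [if_neg hbd]
    by_cases hbu : b = u
    · by_cases hdv : d = v
      · subst hbu hdv
        have := mul_le_mul_of_nonneg_left s6 hc
        simp only [if_true]
        split_ifs <;> linarith
      · have hqd : q d = Dg A d := by
          simp only [q]; rw [if_pos]
          exact ⟨fun hh => hbd (hbu.trans hh.symm), hdv⟩
        rw [hqd] at s2 s4 ⊢
        simp only [if_pos hbu]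
        split_ifs <;> linarith
    · by_cases hbv : b = v
      · by_cases hdu : d = u
        · subst hbv hdu
          rw [cod_comm] at hc
          rw [cod_comm b d] at *
          have := mul_le_mul_of_nonneg_left s6 hc
          simp only [if_true]
          split_ifs <;> linarith
        · have hqd : q d = Dg A d := by
            simp only [q]; rw [if_pos]
            exact ⟨hdu, fun hh => hbd (hbv.trans hh.symm)⟩
          rw [hqd] at s2 s4 ⊢
          simp only [if_pos hbv]
          split_ifs <;> linarith
      · have hqb : q b = Dg A b := by
          simp only [q]; rw [if_pos]
          exact ⟨hbu, hbv⟩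
        rw [hqb] at s1 s3 ⊢
        by_cases hdu : d = u
        · simp only [if_pos hdu]
          split_ifs <;> linarith
        · by_cases hdv : d = v
          · simp only [if_pos hdv]
            split_ifs <;> linarith
          · have hqd : q d = Dg A d := by
              simp only [q]; rw [if_pos]
              exact ⟨hdu, hdv⟩
            rw [hqd] at s2 s4 ⊢
            split_ifs <;> linarith
  have hS : ∑ b, ∑ d, cod A b d * (q b ^ 2 / 2) ≤ 8 * n * ∑ w, q w ^ 2 := by
    rw [Finset.mul_sum]
    refine Finset.sum_le_sum fun b _ => ?_
    rw [← Finset.sum_mul]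
    have := mul_le_mul_of_nonneg_right (h.sum_cod_le b) (by positivity : 0 ≤ q b ^ 2 / 2)
    linarith
  have hS' : ∑ b, ∑ d, cod A b d * (q d ^ 2 / 2) ≤ 8 * n * ∑ w, q w ^ 2 := by
    rw [Finset.sum_comm]
    simp only [fun b d => cod_comm (A := A) d b] at *
    refine le_trans (le_of_eq ?_) hS
    refine Finset.sum_congr rfl fun b _ => Finset.sum_congr rfl fun d _ => ?_
    rw [cod_comm]
  have hW : W A ≤ 2 * (cod A u v * n ^ 2) + 20 * n * ∑ w, q w ^ 2 := by
    calc W A ≤ _ := Finset.sum_le_sum fun b _ => Finset.sum_le_sum fun d _ => hpt b d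
      _ ≤ _ := by
        simp only [Finset.sum_add_distrib]
        have z1 : ∀ x : Fin n, ∑ b, ∑ d, (if b = x then n * q d ^ 2 else 0)
            = n * ∑ w, q w ^ 2 := by
          intro x
          rw [Finset.mul_sum, Finset.sum_eq_single x]
          · simp
          · intro b _ hb; simp [hb]
          · simp
        have z2 : ∀ x : Fin n, ∑ b, ∑ d, (if d = x then n * q b ^ 2 else 0)
            = n * ∑ w, q w ^ 2 := by
          intro x
          rw [Finset.sum_comm]; exact z1 x
        have z3 : ∀ x y : Fin n, ∑ b, ∑ d, (if b = x then if d = y then cod A u v * n ^ 2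
            else 0 else 0) = cod A u v * n ^ 2 := by
          intro x y
          rw [Finset.sum_eq_single x]
          · simp
          · intro b _ hb; simp [hb]
          · simp
        rw [z1, z1, z2, z2, z3, z3]
        linarith
  have hcod : cod A u v = n - t := by rw [ht_def]; ring
  rw [hcod] at hW
  have : 20 * n * ∑ w, q w ^ 2 ≤ 20 * n * (32 * n + 36 * t ^ 2) := by gcongr
  have h5 : n * t * (360 * t) ≤ n * t * n := by gcongr
  nlinarith

lemma caseB (h : PCtx A) (hc : ∀ u v, u ≠ v → (n : ℝ) < 360 * ((n : ℝ) - cod A u v)) :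
    W A ≤ 2 * (n : ℝ) ^ 3 + 2 * (16 * 184320) ^ 3 * (n : ℝ) ^ 2 := by
  have hn0 : (0 : ℝ) ≤ n := Nat.cast_nonneg n
  let S : Finset (Fin n) := Finset.univ.filter fun v => (n : ℝ) ≤ 184320 * Dg A v
  have hS : (S.card : ℝ) ≤ 16 * 184320 := by
    rcases Nat.eq_zero_or_pos n with h0 | h0
    · subst h0
      have : S = ∅ := Finset.eq_empty_of_isEmpty S
      rw [this]; norm_num
    have h0' : (0 : ℝ) < n := by exact_mod_cast h0
    have : (S.card : ℝ) * n ≤ 184320 * (16 * n) := by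
      calc (S.card : ℝ) * n = ∑ _v ∈ S, (n : ℝ) := by simp
        _ ≤ ∑ v ∈ S, 184320 * Dg A v := Finset.sum_le_sum fun v hv => (Finset.mem_filter.1 hv).2
        _ ≤ ∑ v, 184320 * Dg A v := Finset.sum_le_sum_of_subset_of_nonneg (Finset.subset_univ _)
            fun v _ _ => by have := h.D_nonneg v; positivity
        _ = 184320 * ∑ v, Dg A v := by rw [Finset.mul_sum]
        _ ≤ _ := by have := h.sumD; linarith
    nlinarith
  -- codegrees in S
  have hcodS : ∑ b ∈ S, ∑ d ∈ S, (if b = d then 0 else cod A b d) ≤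
      2 * n + 2 * (S.card : ℝ) ^ 3 := by
    have hpt : ∀ c, ∑ b ∈ S, ∑ d ∈ S, (if b = d then 0 else A b c * A d c) ≤
        2 + ∑ b ∈ S, ∑ d ∈ S, ∑ e ∈ S,
          (if b = d ∨ b = e ∨ d = e then 0 else A b c * A d c * A e c) := by
      intro c
      let X := S.filter fun b => A b c = 1
      have hX : ∀ b ∈ S, b ∉ X → A b c = 0 := by
        intro b hb hbX
        rcases h.h01 b c with h | h
        · exact h
        · exact absurd (Finset.mem_filter.2 ⟨hb, h⟩) hbX
      have hX1 : ∀ b ∈ X, A b c = 1 := fun b hb => (Finset.mem_filter.1 hb).2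
      have tnn : ∀ b d e, 0 ≤
          (if b = d ∨ b = e ∨ d = e then 0 else A b c * A d c * A e c) := by
        intro b d e
        split_ifs
        · exact le_rfl
        · exact mul_nonneg (mul_nonneg (h.nonneg _ _) (h.nonneg _ _)) (h.nonneg _ _)
      by_cases hk : X.card ≤ 2
      · have : 0 ≤ ∑ b ∈ S, ∑ d ∈ S, ∑ e ∈ S,
          (if b = d ∨ b = e ∨ d = e then 0 else A b c * A d c * A e c) :=
          Finset.sum_nonneg fun b _ => Finset.sum_nonneg fun d _ => Finset.sum_nonneg
            fun e _ => tnn b d e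
        have e1 : ∑ b ∈ S, ∑ d ∈ S, (if b = d then 0 else A b c * A d c)
            ≤ ∑ b ∈ X, ∑ d ∈ X.erase b, (1 : ℝ) := by
          have sub : X ⊆ S := Finset.filter_subset _ _
          rw [← Finset.sum_subset sub]
          · refine Finset.sum_le_sum fun b hb => ?_
            rw [← Finset.sum_subset ((Finset.erase_subset b X).trans sub)]
            · refine Finset.sum_le_sum fun d hd => ?_
              rw [hX1 b hb, hX1 d (Finset.mem_of_mem_erase hd)]
              split_ifs <;> norm_num
            · intro d hd hdX
              by_cases hbd : b = d
              · simp [hbd]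
              · have : d ∉ X := fun hh => hdX (Finset.mem_erase.2 ⟨fun h => hbd h.symm, hh⟩)
                simp [hX d hd this]
          · intro b hb hbX
            refine Finset.sum_eq_zero fun d _ => ?_
            simp [hX b hb hbX]
        have e2 : ∑ b ∈ X, ∑ d ∈ X.erase b, (1 : ℝ) ≤ 2 := by
          calc ∑ b ∈ X, ∑ d ∈ X.erase b, (1 : ℝ) ≤ ∑ b ∈ X, 1 := by
                refine Finset.sum_le_sum fun b hb => ?_
                simp only [Finset.sum_const, nsmul_eq_mul, mul_one]
                rw [Finset.card_erase_of_mem hb]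
                exact_mod_cast (by omega : X.card - 1 ≤ 1)
            _ ≤ 2 := by simp; exact_mod_cast hk
        linarith
      · have : ∑ b ∈ S, ∑ d ∈ S, (if b = d then 0 else A b c * A d c) ≤
            ∑ b ∈ S, ∑ d ∈ S, ∑ e ∈ S,
          (if b = d ∨ b = e ∨ d = e then 0 else A b c * A d c * A e c) := by
          refine Finset.sum_le_sum fun b hb => Finset.sum_le_sum fun d hd => ?_
          have nn := Finset.sum_nonneg fun e (_ : e ∈ S) => tnn b d e
          by_cases hbd : b = d
          · rw [if_pos hbd]; exact nn
          rw [if_neg hbd]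
          have : ∃ e ∈ X, e ∉ ({b, d} : Finset (Fin n)) := by
            apply Finset.exists_mem_notMem_of_card_lt_card
            have := Finset.card_le_two (a := b) (b := d)
            omega
          obtain ⟨e, heX, he⟩ := this
          simp only [Finset.mem_insert, Finset.mem_singleton, not_or] at he
          refine le_trans ?_ (Finset.single_le_sum (fun e _ => tnn b d e)
            (Finset.mem_filter.1 heX).1)
          rw [if_neg, hX1 e heX, mul_one]
          rintro (hh | hh | hh)
          · exact hbd hh
          · exact he.1 hh.symm
          · exact he.2 hh.symm
        linarith
    have e1 : ∑ b ∈ S, ∑ d ∈ S, (if b = d then 0 else cod A b d)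
        = ∑ c, ∑ b ∈ S, ∑ d ∈ S, (if b = d then 0 else A b c * A d c) := by
      rw [Finset.sum_comm (s := Finset.univ)]
      refine Finset.sum_congr rfl fun b _ => ?_
      rw [Finset.sum_comm (s := Finset.univ)]
      refine Finset.sum_congr rfl fun d _ => ?_
      unfold cod
      split_ifs <;> simp
    have e2 : ∑ c, ∑ b ∈ S, ∑ d ∈ S, ∑ e ∈ S,
          (if b = d ∨ b = e ∨ d = e then 0 else A b c * A d c * A e c)
        = ∑ b ∈ S, ∑ d ∈ S, ∑ e ∈ S, ∑ c,
          (if b = d ∨ b = e ∨ d = e then 0 else A b c * A d c * A e c) := by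
      rw [Finset.sum_comm]
      refine Finset.sum_congr rfl fun b _ => ?_
      rw [Finset.sum_comm]
      refine Finset.sum_congr rfl fun d _ => ?_
      rw [Finset.sum_comm]
    have e3 : ∑ b ∈ S, ∑ d ∈ S, ∑ e ∈ S, ∑ c,
          (if b = d ∨ b = e ∨ d = e then 0 else A b c * A d c * A e c)
        ≤ ∑ b ∈ S, ∑ d ∈ S, ∑ e ∈ S, 2 := by
      refine Finset.sum_le_sum fun b _ => Finset.sum_le_sum fun d _ =>
        Finset.sum_le_sum fun e _ => ?_
      by_cases hh : b = d ∨ b = e ∨ d = e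
      · simp [hh]
      · simp only [if_neg hh]
        push Not at hh
        exact h.h2 b d e hh.1 hh.2.1 hh.2.2
    rw [e1]
    calc _ ≤ _ := Finset.sum_le_sum fun c _ => hpt c
      _ ≤ _ := by
        rw [Finset.sum_add_distrib, e2]
        refine add_le_add ?_ (e3.trans ?_)
        · simp; linarith
        · simp; nlinarith
  have hpt : ∀ b d, (if b = d then 0 else cod A b d * (Dg A b * Dg A d)) ≤
      (if b ∈ S then if d ∈ S then (if b = d then 0 else cod A b d) * (719 / 720 * n ^ 2)
        else 0 else 0) +
      n / 184320 * (cod A b d * Dg A b) + n / 184320 * (cod A b d * Dg A d) := by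
    intro b d
    have hc0 := h.cod_nonneg b d
    have hDb := h.D_nonneg b
    have hDd := h.D_nonneg d
    have s1 : 0 ≤ n / 184320 * (cod A b d * Dg A b) := by positivity
    have s2 : 0 ≤ n / 184320 * (cod A b d * Dg A d) := by positivity
    by_cases hbd : b = d
    · simp only [if_pos hbd, zero_mul, ite_self]
      linarith
    simp only [if_neg hbd]
    by_cases hb : b ∈ S
    · by_cases hd : d ∈ S
      · rw [if_pos hb, if_pos hd]
        have h1 := h.DD_le b d
        have h2 := hc b d hbd
        have h3 : Dg A b + Dg A d ≤ 2 * (719 / 720 * n) := by linarith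
        have h4 : Dg A b * Dg A d ≤ 719 / 720 * n ^ 2 := by
          have : (Dg A b + Dg A d) ^ 2 ≤ (2 * (719 / 720 * n)) ^ 2 := by gcongr
          nlinarith [sq_nonneg (Dg A b - Dg A d), sq_nonneg (n : ℝ)]
        have := mul_le_mul_of_nonneg_left h4 hc0
        linarith
      · have : Dg A d ≤ n / 184320 := by
          have : ¬ ((n : ℝ) ≤ 184320 * Dg A d) := fun hh => hd (Finset.mem_filter.2 ⟨by simp, hh⟩)
          linarith
        have : cod A b d * (Dg A b * Dg A d) ≤ cod A b d * (Dg A b * (n / 184320)) := by gcongr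
        simp only [if_neg hd, ite_self]
        linarith
    · have : Dg A b ≤ n / 184320 := by
        have : ¬ ((n : ℝ) ≤ 184320 * Dg A b) := fun hh => hb (Finset.mem_filter.2 ⟨by simp, hh⟩)
        linarith
      have : cod A b d * (Dg A b * Dg A d) ≤ cod A b d * ((n / 184320) * Dg A d) := by gcongr
      simp only [if_neg hb]
      linarith
  have hw3 : ∑ b, ∑ d, cod A b d * Dg A b ≤ 256 * (n : ℝ) ^ 2 := by
    refine le_trans (le_of_eq ?_) h.walk3
    refine Finset.sum_congr rfl fun b _ => ?_
    rw [← Finset.sum_mul, h.sum_cod, Finset.sum_mul]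
    exact Finset.sum_congr rfl fun c _ => by ring
  have hw3' : ∑ b, ∑ d, cod A b d * Dg A d ≤ 256 * (n : ℝ) ^ 2 := by
    rw [Finset.sum_comm]
    refine le_trans (le_of_eq ?_) hw3
    exact Finset.sum_congr rfl fun b _ => Finset.sum_congr rfl fun d _ => by rw [cod_comm]
  have hW : W A ≤ (2 * n + 2 * (S.card : ℝ) ^ 3) * (719 / 720 * n ^ 2) +
      n / 184320 * (256 * (n : ℝ) ^ 2) + n / 184320 * (256 * (n : ℝ) ^ 2) := by
    calc W A ≤ _ := Finset.sum_le_sum fun b _ => Finset.sum_le_sum fun d _ => hpt b d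
      _ ≤ _ := by
        simp only [Finset.sum_add_distrib]
        refine add_le_add (add_le_add ?_ ?_) ?_
        · have : ∑ b, ∑ d, (if b ∈ S then if d ∈ S then (if b = d then 0 else cod A b d) *
              (719 / 720 * (n : ℝ) ^ 2) else 0 else 0)
              = (∑ b ∈ S, ∑ d ∈ S, (if b = d then 0 else cod A b d)) * (719 / 720 * n ^ 2) := by
            rw [Finset.sum_mul]
            simp only [Finset.sum_mul]
            rw [← Finset.sum_subset (Finset.subset_univ S)]
            · refine Finset.sum_congr rfl fun b hb => ?_
              rw [← Finset.sum_subset (Finset.subset_univ S)]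
              · refine Finset.sum_congr rfl fun d hd => ?_
                rw [if_pos hb, if_pos hd]
              · intro d _ hd
                simp [hd]
            · intro b _ hb
              simp [hb]
          rw [this]
          gcongr
        · simp only [← Finset.mul_sum]
          gcongr
        · simp only [← Finset.mul_sum]
          gcongr
  have hS3 : (S.card : ℝ) ^ 3 ≤ (16 * 184320) ^ 3 := by gcongr
  have : (S.card : ℝ) ^ 3 * n ^ 2 ≤ (16 * 184320) ^ 3 * (n : ℝ) ^ 2 := by gcongr
  have : (0:ℝ) ≤ (S.card : ℝ) ^ 3 * n ^ 2 := by positivity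
  nlinarith

lemma W_le (h : PCtx A) : W A ≤ 2 * (n : ℝ) ^ 3 + 2 * (16 * 184320) ^ 3 * (n : ℝ) ^ 2 := by
  by_cases hc : ∀ u v, u ≠ v → (n : ℝ) < 360 * ((n : ℝ) - cod A u v)
  · exact h.caseB hc
  · push Not at hc
    obtain ⟨u, v, huv, ht⟩ := hc
    refine (h.caseA u v huv ht).trans ?_
    have : (0 : ℝ) ≤ (n : ℝ) ^ 2 := by positivity
    nlinarith

end PCtx

open Classical in
lemma planar_pctx {n : ℕ} {G : SimpleGraph (Fin n)} (h : G.IsPlanar) :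
    PCtx (fun u v => if G.Adj u v then (1 : ℝ) else 0) where
  h01 u v := by by_cases hh : G.Adj u v <;> simp [hh]
  hsym u v := by simp [G.adj_comm]
  hirr u := by simp
  h1 X := by
    have := planar_eCnt h X
    unfold eCnt at this
    exact_mod_cast this
  h2 u v w huv huw hvw := by
    have := planar_common h huv huw hvw
    rw [Finset.card_filter] at this
    have h' : ((∑ c, if G.Adj u c ∧ G.Adj v c ∧ G.Adj w c then 1 else 0 : ℕ) : ℝ) ≤ 2 := by
      exact_mod_cast this
    refine le_trans (le_of_eq ?_) h'
    push_cast
    refine Finset.sum_congr rfl fun c _ => ?_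
    by_cases h1 : G.Adj u c <;> by_cases h2 : G.Adj v c <;> by_cases h3 : G.Adj w c <;>
      simp [h1, h2, h3]

open Classical in
lemma card_le_W {n : ℕ} (G : SimpleGraph (Fin n)) :
    (Nat.card {t : Fin n × Fin n × Fin n × Fin n × Fin n // IsP5 G t} : ℝ) ≤
      PCtx.W (fun u v => if G.Adj u v then (1 : ℝ) else 0) := by
  rw [Nat.card_eq_fintype_card, Fintype.card_subtype, Finset.card_filter]
  push_cast
  rw [Fintype.sum_prod_type]
  simp only [Fintype.sum_prod_type]
  set A : Fin n → Fin n → ℝ := fun u v => if G.Adj u v then (1 : ℝ) else 0 with hA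
  have hpt : ∀ a b c d e : Fin n, (if IsP5 G (a, b, c, d, e) then (1 : ℝ) else 0) ≤
      if b = d then 0 else A b c * A d c * (A b a * A d e) := by
    intro a b c d e
    by_cases hp : IsP5 G (a, b, c, d, e)
    · obtain ⟨h1, h2, h3, h4, h5⟩ := hp
      dsimp only at h1 h2 h3 h4 h5
      have hbd : b ≠ d := by
        simp at h5; tauto
      simp [hA, hbd, h1.symm, h2, h3.symm, h4]
      split_ifs <;> norm_num
    · rw [if_neg hp]
      simp only [hA]
      split_ifs <;> norm_num
  calc _ ≤ ∑ a, ∑ b, ∑ c, ∑ d, ∑ e, (if b = d then 0 else A b c * A d c * (A b a * A d e)) :=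
        Finset.sum_le_sum fun a _ => Finset.sum_le_sum fun b _ => Finset.sum_le_sum fun c _ =>
          Finset.sum_le_sum fun d _ => Finset.sum_le_sum fun e _ => hpt a b c d e
    _ = PCtx.W A := by
      unfold PCtx.W
      rw [Finset.sum_comm]
      refine Finset.sum_congr rfl fun b _ => ?_
      have : ∀ a, ∑ c, ∑ d, ∑ e, (if b = d then 0 else A b c * A d c * (A b a * A d e))
          = ∑ d, ∑ c, ∑ e, (if b = d then 0 else A b c * A d c * (A b a * A d e)) :=
        fun a => Finset.sum_comm
      simp only [this]
      rw [Finset.sum_comm]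
      refine Finset.sum_congr rfl fun d _ => ?_
      by_cases hbd : b = d
      · simp [hbd]
      · simp only [if_neg hbd]
        rw [Finset.sum_comm]
        unfold cod Dg
        rw [Finset.sum_mul]
        refine Finset.sum_congr rfl fun c _ => ?_
        rw [Finset.sum_mul_sum, Finset.mul_sum]
        refine Finset.sum_congr rfl fun a _ => ?_
        rw [Finset.mul_sum]


/-- There is a constant `C` such that every planar graph on `n` vertices has at most
`n³ + C·n²` paths of length 4, and moreover for every `n` some `n`-vertex planar graph
has at least `n³ − C·n²` paths of length 4. -/
theorem stmt_19 :
    ∃ C : ℝ, (∀ (n : ℕ) (G : SimpleGraph (Fin n)), G.IsPlanar →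
        numP4 n G ≤ (n : ℝ) ^ 3 + C * (n : ℝ) ^ 2) ∧
      ∀ n : ℕ, ∃ G : SimpleGraph (Fin n), G.IsPlanar ∧
        (n : ℝ) ^ 3 - C * (n : ℝ) ^ 2 ≤ numP4 n G := by
  refine ⟨(16 * 184320) ^ 3, fun n G hG => ?_, fun n => ?_⟩
  · rw [numP4_eq]
    have h1 := card_le_W G
    have h2 := (planar_pctx hG).W_le
    linarith
  · obtain ⟨G, hG, h⟩ := lower n
    refine ⟨G, hG, le_trans ?_ h⟩
    have : (0 : ℝ) ≤ (n : ℝ) ^ 2 := by positivity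
    nlinarith
end
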